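/- arXiv:1709.00165 — 11 statements merged into one kernel-verified Lean document; each statement's English description precedes it below -/
import Mathlib

section
/- Let N ≥ 2 and let D₁, …, D_N be nonempty bounded open convex subsets of ℝ³ whose closures are pairwise disjoint. Then there exist constants δ₁ ∈ (0,1] and d₃ > 0 such that for all indices j ≠ q in {1,…,N}, all ξ, ζ ∈ frontier(D_j), all η ∈ frontier(D_q), and all δ with 0 < δ ≤ δ₁, one has (1 − δ)·(‖ξ − η‖ + ‖η − ζ‖) ≥ ‖ξ − ζ‖ + 2·d₃. -/
/-- A point outside a convex set satisfies the strict triangle inequality with respect to any two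
points of the set. -/
theorem Convex.dist_lt_dist_add_dist {E : Type*} [NormedAddCommGroup E] [NormedSpace ℝ E]
    [StrictConvexSpace ℝ E] {s : Set E} (hs : Convex ℝ s) {x y z : E}
    (hx : x ∈ s) (hz : z ∈ s) (hy : y ∉ s) : dist x z < dist x y + dist y z := by
  refine (dist_triangle x y z).lt_of_ne fun h => hy ?_
  exact hs.segment_subset hx hz (mem_segment_iff_wbtw.2 (dist_add_dist_eq_iff.1 h.symm))

/-- A strict inequality `f < g` between continuous functions on a compact set holds with a
uniform gap, which survives
multiplication of the larger one by a factor close to `1`. -/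
theorem IsCompact.exists_add_le_one_sub_mul {X : Type*} [TopologicalSpace X] {K : Set X}
    (hK : IsCompact K) {f g : X → ℝ} (hf : Continuous f) (hg : Continuous g)
    (hg0 : ∀ x ∈ K, 0 ≤ g x) (hfg : ∀ x ∈ K, f x < g x) :
    ∃ δ₁ : ℝ, 0 < δ₁ ∧ δ₁ ≤ 1 ∧ ∃ d : ℝ, 0 < d ∧
      ∀ x ∈ K, ∀ δ : ℝ, δ ≤ δ₁ → f x + 2 * d ≤ (1 - δ) * g x := by
  obtain ⟨c, hc, hcle⟩ := hK.exists_forall_le' (hg.sub hf).continuousOn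
    (a := 0) fun x hx => sub_pos.2 (hfg x hx)
  obtain ⟨M, hM⟩ := hK.bddAbove_image hg.continuousOn
  have hM' : 0 < max M 1 := lt_max_of_lt_right one_pos
  refine ⟨min 1 (c / (2 * max M 1)), by positivity, min_le_left _ _, c / 4, by positivity,
    fun x hx δ hδ => ?_⟩
  have hgM : g x ≤ max M 1 := (hM (Set.mem_image_of_mem g hx)).trans (le_max_left _ _)
  have hbound : δ * g x ≤ c / 2 := calc
    δ * g x ≤ c / (2 * max M 1) * g x :=
      mul_le_mul_of_nonneg_right (hδ.trans (min_le_right _ _)) (hg0 x hx)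
    _ ≤ c / (2 * max M 1) * max M 1 := by gcongr
    _ = c / 2 := by field_simp
  have hgap : c ≤ g x - f x := hcle x hx
  linarith


/-- uniform strict triangle inequality for paths through a different
convex cavity boundary. -/
theorem stmt_1 (N : ℕ) (hN : 2 ≤ N) (D : Fin N → Set (EuclideanSpace ℝ (Fin 3)))
    (hne : ∀ j, (D j).Nonempty) (hbd : ∀ j, Bornology.IsBounded (D j))
    (hop : ∀ j, IsOpen (D j)) (hconv : ∀ j, Convex ℝ (D j))
    (hdisj : ∀ j q, j ≠ q → Disjoint (closure (D j)) (closure (D q))) :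
    ∃ δ₁ : ℝ, 0 < δ₁ ∧ δ₁ ≤ 1 ∧ ∃ d₃ : ℝ, 0 < d₃ ∧
      ∀ j q : Fin N, j ≠ q → ∀ ξ ∈ frontier (D j), ∀ ζ ∈ frontier (D j),
        ∀ η ∈ frontier (D q), ∀ δ : ℝ, 0 < δ → δ ≤ δ₁ →
          ‖ξ - ζ‖ + 2 * d₃ ≤ (1 - δ) * (‖ξ - η‖ + ‖η - ζ‖) := by
  have hcpt : ∀ j, IsCompact (closure (D j)) := fun j => (hbd j).isCompact_closure
  let K := ⋃ p ∈ {p : Fin N × Fin N | p.1 ≠ p.2},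
    closure (D p.1) ×ˢ closure (D p.1) ×ˢ closure (D p.2)
  have hK : IsCompact K := (Set.toFinite _).isCompact_biUnion fun p _ =>
    (hcpt p.1).prod ((hcpt p.1).prod (hcpt p.2))
  obtain ⟨δ₁, hδ₁, hδ₁', d, hd, h⟩ := hK.exists_add_le_one_sub_mul
    (f := fun x => ‖x.1 - x.2.1‖) (g := fun x => ‖x.1 - x.2.2‖ + ‖x.2.2 - x.2.1‖)
    (by fun_prop) (by fun_prop) (fun _ _ => by positivity) (by
      intro x hx
      obtain ⟨p, hp, hξ, hζ, hη⟩ := Set.mem_iUnion₂.1 hx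
      simpa only [dist_eq_norm] using (hconv p.1).closure.dist_lt_dist_add_dist hξ hζ
        (Set.disjoint_right.1 (hdisj p.1 p.2 hp) hη))
  refine ⟨δ₁, hδ₁, hδ₁', d, hd, fun j q hjq ξ hξ ζ hζ η hη δ _ hδ => ?_⟩
  exact h (ξ, ζ, η) (Set.mem_iUnion₂.2 ⟨(j, q), hjq, frontier_subset_closure hξ,
    frontier_subset_closure hζ, frontier_subset_closure hη⟩) δ hδ
end

section
/- Let K and Γ be nonempty subsets of ℝ³ and let p ∈ ℝ³. Suppose (ξ₀, y₀) ∈ K × Γ satisfies ‖p − ξ₀‖ + ‖ξ₀ − y₀‖ ≤ ‖p − ξ‖ + ‖ξ − y‖ for all (ξ, y) ∈ K × Γ. If ζ ∈ K and ζ = t·p + (1 − t)·ξ₀ for some t ∈ [0,1], then ‖ζ − ξ₀‖ + ‖ξ₀ − y₀‖ = ‖ζ − y₀‖, i.e. ξ₀ lies on the closed segment joining ζ and y₀. -/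
/-- a point of `K` lying on the segment from `p` to a minimizer `ξ₀`
forces `ξ₀` to lie on the segment joining that point and `y₀`. -/
theorem stmt_2 (p ξ₀ y₀ : EuclideanSpace ℝ (Fin 3))
    (K Γ : Set (EuclideanSpace ℝ (Fin 3))) (hK : K.Nonempty) (hΓ : Γ.Nonempty)
    (hξ₀ : ξ₀ ∈ K) (hy₀ : y₀ ∈ Γ)
    (hmin : ∀ ξ ∈ K, ∀ y ∈ Γ, ‖p - ξ₀‖ + ‖ξ₀ - y₀‖ ≤ ‖p - ξ‖ + ‖ξ - y‖)
    (ζ : EuclideanSpace ℝ (Fin 3)) (hζK : ζ ∈ K)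
    (t : ℝ) (ht0 : 0 ≤ t) (ht1 : t ≤ 1) (hζ : ζ = t • p + (1 - t) • ξ₀) :
    ‖ζ - ξ₀‖ + ‖ξ₀ - y₀‖ = ‖ζ - y₀‖ := by
  have hsplit : ‖p - ζ‖ + ‖ζ - ξ₀‖ = ‖p - ξ₀‖ := by
    have hpζ : p - ζ = (1 - t) • (p - ξ₀) := by rw [hζ]; module
    have hζξ₀ : ζ - ξ₀ = t • (p - ξ₀) := by rw [hζ]; module
    rw [hpζ, hζξ₀, norm_smul_of_nonneg (sub_nonneg.2 ht1), norm_smul_of_nonneg ht0]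
    ring
  linarith [hmin ζ hζK y₀ hy₀, norm_sub_le_norm_sub_add_norm_sub ζ ξ₀ y₀]
end

section
/- Let K and Γ be nonempty subsets of ℝ³ and let p ∈ ℝ³. Suppose (ξ₀, y₀) ∈ K × Γ satisfies ‖p − ξ₀‖ + ‖ξ₀ − y₀‖ ≤ ‖p − ξ‖ + ‖ξ − y‖ for all (ξ, y) ∈ K × Γ, and suppose there exists a vector n ∈ ℝ³ with ⟨n, p − ξ₀⟩ > 0 and ⟨n, y₀ − ξ₀⟩ > 0. Then for every t ∈ (0,1] the point t·p + (1 − t)·ξ₀ does not belong to K; in other words, the segment joining p and ξ₀ meets K only at ξ₀. -/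
open scoped RealInnerProductSpace

/-- The triangle inequality `‖u - v‖ ≤ ‖u‖ + ‖v‖` is strict for two vectors lying in a common
open half-space. -/
theorem norm_sub_lt_of_inner_pos {E : Type*} [NormedAddCommGroup E] [InnerProductSpace ℝ E]
    {n u v : E} (hu : 0 < ⟪n, u⟫) (hv : 0 < ⟪n, v⟫) : ‖u - v‖ < ‖u‖ + ‖v‖ := by
  refine (norm_sub_le u v).lt_of_ne fun h => ?_
  have hray : SameRay ℝ u (-v) := by
    rw [sameRay_iff_norm_add, ← sub_eq_add_neg, norm_neg, h]
  have hu0 : 0 < ‖u‖ := norm_pos_iff.2 fun h0 => by simp [h0] at hu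
  have hinner := congrArg (fun x => ⟪n, x⟫) (sameRay_iff_norm_smul_eq.1 hray)
  simp only [norm_neg, inner_smul_right, inner_neg_right] at hinner
  nlinarith [mul_pos hu0 hv, mul_nonneg (norm_nonneg v) hu.le]

/-- for a minimizer `(ξ₀, y₀)` belonging to `𝓜₁(p)`, the open segment
from `p` to `ξ₀` does not meet `K` except at `ξ₀`. -/
theorem stmt_3 (p ξ₀ y₀ : EuclideanSpace ℝ (Fin 3))
    (K Γ : Set (EuclideanSpace ℝ (Fin 3))) (hK : K.Nonempty) (hΓ : Γ.Nonempty)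
    (hξ₀ : ξ₀ ∈ K) (hy₀ : y₀ ∈ Γ)
    (hmin : ∀ ξ ∈ K, ∀ y ∈ Γ, ‖p - ξ₀‖ + ‖ξ₀ - y₀‖ ≤ ‖p - ξ‖ + ‖ξ - y‖)
    (n : EuclideanSpace ℝ (Fin 3))
    (hn1 : 0 < ⟪n, p - ξ₀⟫) (hn2 : 0 < ⟪n, y₀ - ξ₀⟫) :
    ∀ t : ℝ, 0 < t → t ≤ 1 → t • p + (1 - t) • ξ₀ ∉ K := by
  intro t ht ht1 hmem
  have hle := hmin _ hmem _ hy₀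
  have hp : p - (t • p + (1 - t) • ξ₀) = (1 - t) • (p - ξ₀) := by module
  have hy : t • p + (1 - t) • ξ₀ - y₀ = t • (p - ξ₀) - (y₀ - ξ₀) := by module
  have hlt : ‖t • (p - ξ₀) - (y₀ - ξ₀)‖ < ‖t • (p - ξ₀)‖ + ‖y₀ - ξ₀‖ :=
    norm_sub_lt_of_inner_pos (by rw [inner_smul_right]; exact mul_pos ht hn1) hn2
  rw [norm_smul, Real.norm_of_nonneg ht.le] at hlt
  rw [hp, hy, norm_smul, Real.norm_of_nonneg (sub_nonneg.2 ht1), norm_sub_rev ξ₀ y₀] at hle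
  linarith
end

section
/- Let N ≥ 1 and let D₁, …, D_N be nonempty bounded open convex subsets of ℝ³ with pairwise disjoint closures; set ∂D = ⋃_{j=1}^N frontier(D_j). Let p ∈ ℝ³ with p ∉ ⋃_{j=1}^N closure(D_j). Let ν : ∂D → ℝ³ be a continuous map such that for each j, each ξ ∈ frontier(D_j) and each z ∈ closure(D_j) one has ⟨ν(ξ), z − ξ⟩ ≤ 0 (outward supporting property). Define G⁺(p) = {ξ ∈ ∂D : ⟨ν(ξ), p − ξ⟩ > 0} and G^{+,0}(p) = {ξ ∈ G⁺(p) : t·p + (1 − t)·ξ ∉ ∂D for all t ∈ (0,1]}. Then G^{+,0}(p) is an open subset of ∂D in the subspace topology; in particular G^{+,0}(p) ∩ frontier(D_m) is open in ∂D for each m. -/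
open scoped RealInnerProductSpace

/-- The points from which the whole segment to `p` avoids a closed set form an open set. -/
theorem isOpen_setOf_segment_avoids {E : Type*} [NormedAddCommGroup E] [NormedSpace ℝ E]
    {F : Set E} (hF : IsClosed F) (p : E) :
    IsOpen {x : E | ∀ t ∈ Set.Icc (0 : ℝ) 1, t • p + (1 - t) • x ∉ F} := by
  rw [isOpen_iff_eventually]
  intro x hx
  refine isCompact_Icc.eventually_forall_of_forall_eventually fun t ht => ?_
  have hcont : Continuous fun z : E × ℝ => z.2 • p + (1 - z.2) • z.1 := by fun_prop
  exact (hF.isOpen_compl.preimage hcont).mem_nhds (hx t ht)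

/-- A segment issuing from `ξ` towards the open half-space beyond a supporting hyperplane
of `K` at `ξ` leaves `K` at once. -/
theorem segment_notMem_of_supporting {E : Type*} [NormedAddCommGroup E] [InnerProductSpace ℝ E]
    {K : Set E} {ξ n p : E} (hK : ∀ z ∈ K, ⟪n, z - ξ⟫ ≤ 0) (hp : 0 < ⟪n, p - ξ⟫)
    {t : ℝ} (ht : 0 < t) : t • p + (1 - t) • ξ ∉ K := by
  intro hmem
  have hle := hK _ hmem
  rw [show t • p + (1 - t) • ξ - ξ = t • (p - ξ) by module, real_inner_smul_right] at hle
  exact absurd hle (not_le.mpr (mul_pos ht hp))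

/-- `G^{+,0}(p)` is relatively open in the union of the cavity
boundaries, and so is its intersection with each `frontier (D m)`. -/
theorem stmt_4 (N : ℕ) (hN : 1 ≤ N) (D : Fin N → Set (EuclideanSpace ℝ (Fin 3)))
    (hne : ∀ j, (D j).Nonempty) (hbd : ∀ j, Bornology.IsBounded (D j))
    (hop : ∀ j, IsOpen (D j)) (hconv : ∀ j, Convex ℝ (D j))
    (hdisj : ∀ j q, j ≠ q → Disjoint (closure (D j)) (closure (D q)))
    (p : EuclideanSpace ℝ (Fin 3)) (hp : p ∉ ⋃ j, closure (D j))
    (bdry : Set (EuclideanSpace ℝ (Fin 3))) (hbdry : bdry = ⋃ j, frontier (D j))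
    (ν : EuclideanSpace ℝ (Fin 3) → EuclideanSpace ℝ (Fin 3))
    (hν : ContinuousOn ν bdry)
    (hsupp : ∀ j, ∀ ξ ∈ frontier (D j), ∀ z ∈ closure (D j), ⟪ν ξ, z - ξ⟫ ≤ 0)
    (Gplus Gp0 : Set (EuclideanSpace ℝ (Fin 3)))
    (hGplus : Gplus = {ξ ∈ bdry | 0 < ⟪ν ξ, p - ξ⟫})
    (hGp0 : Gp0 = {ξ ∈ Gplus | ∀ t : ℝ, 0 < t → t ≤ 1 → t • p + (1 - t) • ξ ∉ bdry}) :
    IsOpen {x : ↥bdry | (x : EuclideanSpace ℝ (Fin 3)) ∈ Gp0} ∧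
      ∀ m : Fin N,
        IsOpen {x : ↥bdry | (x : EuclideanSpace ℝ (Fin 3)) ∈ Gp0 ∩ frontier (D m)} := by
  subst hbdry hGplus hGp0
  have hfr : ∀ j q, j ≠ q → ∀ x ∈ frontier (D j), x ∉ frontier (D q) := fun j q hjq x hx hx' =>
    Set.disjoint_left.mp (hdisj j q hjq) (frontier_subset_closure hx) (frontier_subset_closure hx')
  have hpos : IsOpen {x : ↥(⋃ j, frontier (D j)) |
      0 < ⟪ν (x : EuclideanSpace ℝ (Fin 3)), p - (x : EuclideanSpace ℝ (Fin 3))⟫} := by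
    have hνr : Continuous fun x : ↥(⋃ j, frontier (D j)) => ν x := hν.domRestrict
    exact isOpen_lt continuous_const (hνr.inner (continuous_const.sub continuous_subtype_val))
  have hpiece : ∀ m : Fin N, IsOpen {x : ↥(⋃ j, frontier (D j)) |
      (x : EuclideanSpace ℝ (Fin 3)) ∈
        {ξ ∈ {ξ ∈ ⋃ j, frontier (D j) | 0 < ⟪ν ξ, p - ξ⟫} |
          ∀ t : ℝ, 0 < t → t ≤ 1 → t • p + (1 - t) • ξ ∉ ⋃ j, frontier (D j)} ∩
        frontier (D m)} := by
    intro m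
    have hclosed : IsClosed (⋃ j : {j : Fin N // j ≠ m}, frontier (D j)) :=
      isClosed_iUnion_of_finite fun _ => isClosed_frontier
    convert hpos.inter
      ((isOpen_setOf_segment_avoids hclosed p).preimage continuous_subtype_val) using 1
    ext ⟨x, hx⟩
    simp only [Set.mem_ofPred_eq, Set.mem_inter_iff, Set.mem_preimage, Set.mem_iUnion,
      not_exists, Subtype.forall, Set.mem_Icc]
    constructor
    · rintro ⟨⟨⟨-, hx0⟩, hseg⟩, hxm⟩
      refine ⟨hx0, fun t ht j hj => ?_⟩
      rcases ht.1.eq_or_lt with rfl | ht0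
      · simpa using hfr m j hj.symm x hxm
      · exact hseg t ht0 ht.2 j
    · rintro ⟨hx0, hseg⟩
      have hxm : x ∈ frontier (D m) := by
        obtain ⟨j, hj⟩ := Set.mem_iUnion.mp hx
        by_cases hjm : j = m
        · exact hjm ▸ hj
        · exact absurd hj (by simpa using hseg 0 (by simp) j hjm)
      refine ⟨⟨⟨⟨m, hxm⟩, hx0⟩, fun t ht0 ht1 j => ?_⟩, hxm⟩
      by_cases hjm : j = m
      · subst hjm
        exact fun hmem => segment_notMem_of_supporting (hsupp j x hxm) hx0 ht0
          (frontier_subset_closure hmem)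
      · exact hseg t ⟨ht0.le, ht1⟩ j hjm
  refine ⟨?_, hpiece⟩
  convert isOpen_iUnion hpiece using 1
  ext ⟨x, hx⟩
  simp only [Set.mem_ofPred_eq, Set.mem_iUnion, Set.mem_inter_iff, exists_and_left]
  exact ⟨fun h => ⟨h, Set.mem_iUnion.mp hx⟩, fun h => h.1⟩
end

section
/- Let E be a real inner product space. Let ξ, η, ζ ∈ E with η ≠ ξ and ζ ≠ ξ, and let e ∈ E be a unit vector with ⟨η − ξ, e⟩ = 0. Then ‖ξ − ζ‖ + ‖ζ − η‖ ≥ ‖ξ − η‖ + ⟨ζ − ξ, e⟩² / (2·‖ζ − ξ‖). -/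
open scoped RealInnerProductSpace

/-- Bessel's inequality for a pair of orthogonal unit vectors. -/
theorem inner_sq_add_inner_sq_le_norm_sq {E : Type*} [NormedAddCommGroup E]
    [InnerProductSpace ℝ E] {u e : E} (hu : ‖u‖ = 1) (he : ‖e‖ = 1) (hue : ⟪u, e⟫ = 0) (w : E) :
    ⟪w, u⟫ ^ 2 + ⟪w, e⟫ ^ 2 ≤ ‖w‖ ^ 2 := by
  have h : ‖w - (⟪w, u⟫ • u + ⟪w, e⟫ • e)‖ ^ 2 = ‖w‖ ^ 2 - (⟪w, u⟫ ^ 2 + ⟪w, e⟫ ^ 2) := by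
    rw [norm_sub_sq_real, norm_add_sq_real, inner_add_right]
    simp only [norm_smul, real_inner_smul_left, real_inner_smul_right, hu, he, hue, mul_one,
      Real.norm_eq_abs, sq_abs]
    ring
  linarith [sq_nonneg ‖w - (⟪w, u⟫ • u + ⟪w, e⟫ • e)‖]

/-- quantitative strict triangle inequality for broken paths through a
point displaced in a direction orthogonal to the chord. -/
theorem stmt_5 {E : Type*} [NormedAddCommGroup E] [InnerProductSpace ℝ E]
    (ξ η ζ e : E) (hη : η ≠ ξ) (hζ : ζ ≠ ξ) (he : ‖e‖ = 1)
    (horth : ⟪η - ξ, e⟫ = 0) :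
    ‖ξ - η‖ + ⟪ζ - ξ, e⟫ ^ 2 / (2 * ‖ζ - ξ‖) ≤ ‖ξ - ζ‖ + ‖ζ - η‖ := by
  have hd : 0 < ‖η - ξ‖ := norm_pos_iff.mpr (sub_ne_zero.mpr hη)
  have ha : 0 < ‖ζ - ξ‖ := norm_pos_iff.mpr (sub_ne_zero.mpr hζ)
  rw [norm_sub_rev ξ η, norm_sub_rev ξ ζ, norm_sub_rev ζ η]
  set u : E := ‖η - ξ‖⁻¹ • (η - ξ) with hu_def
  have hu : ‖u‖ = 1 := by
    rw [hu_def, norm_smul, norm_inv, norm_norm, inv_mul_cancel₀ hd.ne']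
  have hue : ⟪u, e⟫ = 0 := by rw [hu_def, real_inner_smul_left, horth, mul_zero]
  have hchord : ⟪η - ξ, u⟫ = ‖η - ξ‖ := by
    rw [hu_def, real_inner_smul_right, real_inner_self_eq_norm_sq]
    field_simp
  have hbessel := inner_sq_add_inner_sq_le_norm_sq hu he hue (ζ - ξ)
  have hproj : ‖η - ξ‖ - ⟪ζ - ξ, u⟫ ≤ ‖η - ζ‖ := by
    have h := real_inner_le_norm (η - ζ) u
    rwa [hu, mul_one, ← sub_sub_sub_cancel_right η ζ ξ, inner_sub_left, hchord,
      sub_sub_sub_cancel_right] at h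
  have hdefect : ⟪ζ - ξ, e⟫ ^ 2 / (2 * ‖ζ - ξ‖) ≤ ‖ζ - ξ‖ - ⟪ζ - ξ, u⟫ := by
    rw [div_le_iff₀ (by positivity)]
    linarith [sq_nonneg (‖ζ - ξ‖ - ⟪ζ - ξ, u⟫)]
  linarith
end

section
/- Let M₀, M₂, r₁ > 0 and let a₁₁, a₁₂, a₂₁, a₂₂ : ℝ² → ℝ be functions satisfying: |a_{ij}(σ)| ≤ M₂ for all i, j and all σ with ‖σ‖ ≤ r₁; and |a₁₁(σ) − a₁₁(σ⁰)| ≤ M₀/4 for all σ with ‖σ‖ ≤ r₁, where σ⁰ = (σ₁⁰, 0) with 0 < σ₁⁰ < r₁ and a₁₁(σ⁰) ≥ M₀. Define g(σ) = a₁₁(σ)σ₁² + a₁₂(σ)σ₁σ₂ + a₂₁(σ)σ₂σ₁ + a₂₂(σ)σ₂² and set ε = min{1/2, M₀²/(2·(64·M₂)²)}. Then for every σ = (σ₁, σ₂) with ‖σ‖ ≤ r₁, 0 < σ₁ < (2/3)·σ₁⁰ and σ₁ ≥ (1 − ε)·‖σ‖, one has g(σ⁰)/σ₁⁰ − g(σ)/σ₁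 ≥ (M₀/12)·σ₁⁰. -/
/-- A planar vector whose direction is close to the first axis has small second coordinate. -/
theorem abs_snd_le_of_near_axis {M₀ M₂ ε N x y : ℝ} (hM₀ : 0 < M₀) (hM₂ : 0 < M₂) (hx : 0 < x)
    (hN : 0 ≤ N) (hNxy : N ^ 2 = x ^ 2 + y ^ 2) (hε : ε ≤ 1 / 2) (hε₀ : 0 ≤ ε)
    (hεM : ε ≤ M₀ ^ 2 / (2 * (64 * M₂) ^ 2)) (h : (1 - ε) * N ≤ x) :
    32 * M₂ * |y| ≤ M₀ * x := by
  have hN2 : N ≤ 2 * x := by nlinarith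
  have hsq : ((1 - ε) * N) ^ 2 ≤ x ^ 2 :=
    pow_le_pow_left₀ (mul_nonneg (by linarith) hN) h 2
  have hNsq : N ^ 2 ≤ (2 * x) ^ 2 := pow_le_pow_left₀ hN hN2 2
  have hy : y ^ 2 ≤ 8 * ε * x ^ 2 := by
    nlinarith [mul_le_mul_of_nonneg_left hNsq hε₀, mul_nonneg (sq_nonneg ε) (sq_nonneg N)]
  rw [le_div_iff₀ (by positivity)] at hεM
  refine abs_le_of_sq_le_sq' ?_ (by positivity) |>.2
  rw [mul_pow, sq_abs]
  nlinarith [mul_le_mul_of_nonneg_left hy (sq_nonneg (32 * M₂)),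
    mul_le_mul_of_nonneg_right hεM (sq_nonneg x)]

/-- key slope estimate for the graph function of a strictly convex
surface written in second-order Taylor form. -/
theorem stmt_6 (M₀ M₂ r₁ : ℝ) (hM₀ : 0 < M₀) (hM₂ : 0 < M₂) (hr₁ : 0 < r₁)
    (a : Fin 2 → Fin 2 → EuclideanSpace ℝ (Fin 2) → ℝ)
    (σ₀ : EuclideanSpace ℝ (Fin 2)) (hσ₀1 : σ₀ 1 = 0)
    (hσ₀pos : 0 < σ₀ 0) (hσ₀lt : σ₀ 0 < r₁)
    (hbound : ∀ i j, ∀ σ : EuclideanSpace ℝ (Fin 2), ‖σ‖ ≤ r₁ → |a i j σ| ≤ M₂)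
    (hosc : ∀ σ : EuclideanSpace ℝ (Fin 2), ‖σ‖ ≤ r₁ → |a 0 0 σ - a 0 0 σ₀| ≤ M₀ / 4)
    (ha11 : M₀ ≤ a 0 0 σ₀)
    (g : EuclideanSpace ℝ (Fin 2) → ℝ)
    (hg : ∀ σ : EuclideanSpace ℝ (Fin 2), g σ = ∑ i, ∑ j, a i j σ * σ i * σ j)
    (ε : ℝ) (hε : ε = min (1 / 2) (M₀ ^ 2 / (2 * (64 * M₂) ^ 2))) :
    ∀ σ : EuclideanSpace ℝ (Fin 2), ‖σ‖ ≤ r₁ → 0 < σ 0 → σ 0 < (2 / 3) * σ₀ 0 →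
      (1 - ε) * ‖σ‖ ≤ σ 0 →
      (M₀ / 12) * σ₀ 0 ≤ g σ₀ / σ₀ 0 - g σ / σ 0 := by
  intro σ hσ hx hxs hcone
  have hnorm : ∀ τ : EuclideanSpace ℝ (Fin 2), ‖τ‖ ^ 2 = τ 0 ^ 2 + τ 1 ^ 2 := fun τ => by
    simp [EuclideanSpace.norm_sq_eq, Fin.sum_univ_two]
  have hσ₀ : ‖σ₀‖ ≤ r₁ := by
    refine abs_le_of_sq_le_sq' ?_ hr₁.le |>.2
    rw [hnorm, hσ₀1]
    nlinarith
  have hMM : M₀ ≤ M₂ := ha11.trans ((le_abs_self _).trans (hbound 0 0 σ₀ hσ₀))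
  have hy : 32 * M₂ * |σ 1| ≤ M₀ * σ 0 :=
    abs_snd_le_of_near_axis hM₀ hM₂ hx (norm_nonneg σ) (hnorm σ) (hε ▸ min_le_left _ _)
      (hε ▸ le_min (by norm_num) (by positivity)) (hε ▸ min_le_right _ _) hcone
  have hyx : 32 * |σ 1| ≤ σ 0 := by
    refine le_of_mul_le_mul_left ?_ hM₂
    nlinarith
  have hdiag : a 0 0 σ * σ 0 ≤ (a 0 0 σ₀ + M₀ / 4) * σ 0 :=
    mul_le_mul_of_nonneg_right (by linarith [(abs_le.1 (hosc σ hσ)).2]) hx.le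
  have hmain : (a 0 0 σ₀ + M₀ / 4) * σ 0 ≤ (a 0 0 σ₀ + M₀ / 4) * (2 / 3 * σ₀ 0) :=
    mul_le_mul_of_nonneg_left hxs.le (by linarith)
  have hoff : ∀ i j, a i j σ * σ 1 ≤ M₂ * |σ 1| := fun i j => by
    refine (le_abs_self _).trans ?_
    rw [abs_mul]
    exact mul_le_mul_of_nonneg_right (hbound i j σ hσ) (abs_nonneg _)
  have hquad : a 1 1 σ * σ 1 * (σ 1 / σ 0) ≤ M₂ * |σ 1| := by
    refine (le_abs_self _).trans ?_
    rw [abs_mul, abs_mul]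
    have hratio : |σ 1 / σ 0| ≤ 1 := by
      rw [abs_div, abs_of_pos hx, div_le_one hx]
      linarith [abs_nonneg (σ 1)]
    exact (mul_le_of_le_one_right (by positivity) hratio).trans
      (mul_le_mul_of_nonneg_right (hbound 1 1 σ hσ) (abs_nonneg _))
  have hg₀ : g σ₀ / σ₀ 0 = a 0 0 σ₀ * σ₀ 0 := by
    simp only [hg, Fin.sum_univ_two, hσ₀1]
    field_simp
    ring
  have hgσ : g σ / σ 0 =
      a 0 0 σ * σ 0 + a 0 1 σ * σ 1 + a 1 0 σ * σ 1 + a 1 1 σ * σ 1 * (σ 1 / σ 0) := by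
    simp only [hg, Fin.sum_univ_two]
    field_simp
    ring
  rw [hg₀, hgσ]
  have hAs : M₀ * σ₀ 0 ≤ a 0 0 σ₀ * σ₀ 0 := mul_le_mul_of_nonneg_right ha11 hσ₀pos.le
  have hMx : M₀ * σ 0 ≤ M₀ * (2 / 3 * σ₀ 0) := mul_le_mul_of_nonneg_left hxs.le hM₀.le
  have herr : a 0 1 σ * σ 1 + a 1 0 σ * σ 1 + a 1 1 σ * σ 1 * (σ 1 / σ 0) ≤
      3 * (M₂ * |σ 1|) := by
    linarith only [hoff 0 1, hoff 1 0, hquad]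
  linarith only [herr, hy, hMx, hAs, hmain, hdiag, mul_pos hM₀ hσ₀pos]
end

section
/- Let A > 0, d₁ > 0, let L ⊂ ℝ³ be a nonempty compact set, and let ν be a Borel measure on ℝ³ supported in L with ν(B(x, r)) ≤ A·r² for all x ∈ ℝ³ and r > 0. Then there exists a constant C > 0, depending only on A, d₁ and the diameter of L, such that: (a) for every ξ ∈ ℝ³ with dist(ξ, L) ≥ 2·d₁, every μ > 0 and every δ ∈ (0,1], ∫_L (μ + ‖ξ−ζ‖^{−1})·e^{−μδ‖ξ−ζ‖} dν(ζ) ≤ C·δ^{−1}·e^{−d₁δμ}; and (b) for every ξ ∈ ℝ³, every q ∈ {0,1}, every μ > 0 and every δ ∈ (0,1], ∫_L (μ + ‖ξ−ζ‖^{−1})·e^{−μδ‖ξ−ζ‖} dν(ζ) ≤ C·δ^{−1−q}·μ^{−q}. -/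
open MeasureTheory

section PolarBounds

open Set Filter Topology

/-- `r⁻¹ e^{-ar}` is the tail integral of `(s⁻² + a s⁻¹) e^{-as}`. -/
lemma ofReal_inv_mul_exp_neg_eq_lintegral_Ioi {a r : ℝ} (ha : 0 < a) (hr : 0 < r) :
    ENNReal.ofReal (r⁻¹ * Real.exp (-(a * r))) =
      ∫⁻ s in Ioi r, ENNReal.ofReal (((s ^ 2)⁻¹ + a * s⁻¹) * Real.exp (-(a * s))) := by
  have hderiv : ∀ s ∈ Ici r, HasDerivAt (fun s : ℝ => s⁻¹ * Real.exp (-(a * s)))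
      (-(((s ^ 2)⁻¹ + a * s⁻¹) * Real.exp (-(a * s)))) s := by
    intro s hs
    have hs0 : s ≠ 0 := (hr.trans_le hs).ne'
    have hlin : HasDerivAt (fun s : ℝ => -(a * s)) (-a) s := ((hasDerivAt_id s).const_mul a).neg.congr_deriv (by simp)
    refine ((hasDerivAt_inv hs0).mul hlin.exp).congr_deriv ?_
    ring
  have hnonneg : ∀ s ∈ Ioi r, 0 ≤ ((s ^ 2)⁻¹ + a * s⁻¹) * Real.exp (-(a * s)) := by
    intro s hs
    have hs0 : 0 < s := hr.trans hs
    positivity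
  have hnonpos : ∀ s ∈ Ioi r, -(((s ^ 2)⁻¹ + a * s⁻¹) * Real.exp (-(a * s))) ≤ 0 :=
    fun s hs => neg_nonpos.2 (hnonneg s hs)
  have hlim : Tendsto (fun s : ℝ => s⁻¹ * Real.exp (-(a * s))) atTop (𝓝 0) := by
    have hexp : Tendsto (fun s : ℝ => Real.exp (-(a * s))) atTop (𝓝 0) :=
      Real.tendsto_exp_neg_atTop_nhds_zero.comp (tendsto_id.const_mul_atTop ha)
    simpa using tendsto_inv_atTop_zero.mul hexp
  have hint := integrableOn_Ioi_deriv_of_nonpos' hderiv hnonpos hlim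
  have hval := integral_Ioi_of_hasDerivAt_of_nonpos' hderiv hnonpos hlim
  rw [integral_neg, zero_sub, neg_inj] at hval
  rw [← hval, ofReal_integral_eq_lintegral_ofReal]
  · simpa [IntegrableOn] using hint.neg
  · exact (ae_restrict_mem measurableSet_Ioi).mono hnonneg

lemma lintegral_Ioi_two_mul_exp_neg {a : ℝ} (ha : 0 < a) :
    ∫⁻ s in Ioi (0 : ℝ), ENNReal.ofReal (2 * Real.exp (-a / 2 * s)) =
      ENNReal.ofReal (4 / a) := by
  have hneg : -a / 2 < 0 := by linarith
  rw [← ofReal_integral_eq_lintegral_ofReal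
    ((integrableOn_exp_mul_Ioi hneg 0).const_mul 2) (ae_of_all _ fun s => by positivity),
    integral_const_mul, integral_exp_mul_Ioi hneg]
  congr 1
  simp
  field_simp
  norm_num

variable {E : Type*} [NormedAddCommGroup E] [MeasurableSpace E]
  {ν : Measure E} {A : ℝ}

lemma measure_singleton_eq_zero_of_quadratic_growth
    (hν : ∀ (x : E) (r : ℝ), 0 < r → ν (Metric.ball x r) ≤ ENNReal.ofReal (A * r ^ 2))
    (ξ : E) : ν {ξ} = 0 := by
  have hlim : Tendsto (fun r : ℝ => ENNReal.ofReal (A * r ^ 2)) (𝓝[>] 0) (𝓝 0) := by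
    have hcont : Continuous fun r : ℝ => ENNReal.ofReal (A * r ^ 2) :=
      ENNReal.continuous_ofReal.comp (by fun_prop)
    simpa using (hcont.tendsto 0).mono_left nhdsWithin_le_nhds
  refine le_antisymm (ge_of_tendsto hlim ?_) zero_le
  filter_upwards [self_mem_nhdsWithin] with r hr
  exact (measure_mono (singleton_subset_iff.2 (Metric.mem_ball_self hr))).trans (hν ξ r hr)

lemma ae_norm_sub_pos_of_quadratic_growth
    (hν : ∀ (x : E) (r : ℝ), 0 < r → ν (Metric.ball x r) ≤ ENNReal.ofReal (A * r ^ 2))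
    (ξ : E) : ∀ᵐ ζ ∂ν, 0 < ‖ξ - ζ‖ := by
  have hne : ∀ᵐ ζ ∂ν, ζ ≠ ξ := by
    simpa [ae_iff] using measure_singleton_eq_zero_of_quadratic_growth hν ξ
  filter_upwards [hne] with ζ hζ
  exact norm_pos_iff.2 (sub_ne_zero.2 hζ.symm)

variable [BorelSpace E] [SFinite ν]

lemma lintegral_inv_norm_mul_exp_neg_le (hA : 0 < A)
    (hν : ∀ (x : E) (r : ℝ), 0 < r → ν (Metric.ball x r) ≤ ENNReal.ofReal (A * r ^ 2))
    (ξ : E) {a : ℝ} (ha : 0 < a) :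
    ∫⁻ ζ, ENNReal.ofReal (‖ξ - ζ‖⁻¹ * Real.exp (-(a * ‖ξ - ζ‖))) ∂ν ≤
      ENNReal.ofReal (A * (4 / a)) := by
  set h : ℝ → ENNReal := fun s =>
    ENNReal.ofReal (((s ^ 2)⁻¹ + a * s⁻¹) * Real.exp (-(a * s))) with hh
  have hmeas_h : Measurable h := by fun_prop
  have hnorm : Measurable fun ζ : E => ‖ξ - ζ‖ :=
    (continuous_const.sub continuous_id).norm.measurable
  have hset : MeasurableSet {p : E × ℝ | ‖ξ - p.1‖ < p.2} :=
    measurableSet_lt (hnorm.comp measurable_fst) measurable_snd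
  calc ∫⁻ ζ, ENNReal.ofReal (‖ξ - ζ‖⁻¹ * Real.exp (-(a * ‖ξ - ζ‖))) ∂ν
      = ∫⁻ ζ, (∫⁻ s in Ioi (0 : ℝ),
          {p : E × ℝ | ‖ξ - p.1‖ < p.2}.indicator (fun p => h p.2) (ζ, s)) ∂ν := by
        refine lintegral_congr_ae ?_
        filter_upwards [ae_norm_sub_pos_of_quadratic_growth hν ξ] with ζ hζ
        rw [ofReal_inv_mul_exp_neg_eq_lintegral_Ioi ha hζ]
        have hind : (fun s : ℝ =>
            {p : E × ℝ | ‖ξ - p.1‖ < p.2}.indicator (fun p => h p.2) (ζ, s)) =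
            (Ioi ‖ξ - ζ‖).indicator h := by
          ext s
          simp [indicator]
        rw [hind, lintegral_indicator measurableSet_Ioi,
          Measure.restrict_restrict measurableSet_Ioi,
          inter_eq_left.2 (Ioi_subset_Ioi hζ.le)]
    _ = ∫⁻ s in Ioi (0 : ℝ), ∫⁻ ζ,
          {p : E × ℝ | ‖ξ - p.1‖ < p.2}.indicator (fun p => h p.2) (ζ, s) ∂ν :=
        lintegral_lintegral_swap
          ((hmeas_h.comp measurable_snd).indicator hset).aemeasurable
    _ ≤ ∫⁻ s in Ioi (0 : ℝ),
          ENNReal.ofReal A * ENNReal.ofReal (2 * Real.exp (-a / 2 * s)) := by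
        refine setLIntegral_mono' measurableSet_Ioi fun s hs => ?_
        have hs0 : 0 < s := hs
        have hind : (fun ζ : E =>
            {p : E × ℝ | ‖ξ - p.1‖ < p.2}.indicator (fun p => h p.2) (ζ, s)) =
            (Metric.ball ξ s).indicator fun _ => h s := by
          ext ζ
          simp [indicator, dist_eq_norm']
        rw [hind, lintegral_indicator_const measurableSet_ball]
        refine (mul_le_mul_right (hν ξ s hs0) (h s)).trans ?_
        rw [hh, ← ENNReal.ofReal_mul (by positivity), ← ENNReal.ofReal_mul hA.le]
        refine ENNReal.ofReal_le_ofReal ?_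
        have hexp : Real.exp (-(a * s)) =
            Real.exp (-a / 2 * s) * Real.exp (-a / 2 * s) := by
          rw [← Real.exp_add]; ring_nf
        have hle : (1 + a * s) * Real.exp (-a / 2 * s) ≤ 2 := by
          have hone : Real.exp (a / 2 * s) * Real.exp (-a / 2 * s) = 1 := by
            rw [← Real.exp_add]; ring_nf; simp
          have hadd := Real.add_one_le_exp (a / 2 * s)
          have hpos := Real.exp_pos (-a / 2 * s)
          nlinarith
        calc ((s ^ 2)⁻¹ + a * s⁻¹) * Real.exp (-(a * s)) * (A * s ^ 2)
            = A * (((1 + a * s) * Real.exp (-a / 2 * s)) * Real.exp (-a / 2 * s)) := by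
              rw [hexp]; field_simp
          _ ≤ A * (2 * Real.exp (-a / 2 * s)) := by gcongr
    _ = ENNReal.ofReal (A * (4 / a)) := by
        rw [lintegral_const_mul' _ _ ENNReal.ofReal_ne_top, lintegral_Ioi_two_mul_exp_neg ha,
          ENNReal.ofReal_mul hA.le]

lemma integrable_inv_norm_mul_exp_neg (hA : 0 < A)
    (hν : ∀ (x : E) (r : ℝ), 0 < r → ν (Metric.ball x r) ≤ ENNReal.ofReal (A * r ^ 2))
    (ξ : E) {a : ℝ} (ha : 0 < a) :
    Integrable (fun ζ => ‖ξ - ζ‖⁻¹ * Real.exp (-(a * ‖ξ - ζ‖))) ν := by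
  have hnorm : Measurable fun ζ : E => ‖ξ - ζ‖ :=
    (continuous_const.sub continuous_id).norm.measurable
  refine ⟨(hnorm.inv.mul (hnorm.const_mul a).neg.exp).aestronglyMeasurable, ?_⟩
  rw [hasFiniteIntegral_iff_ofReal (ae_of_all _ fun ζ => by positivity)]
  exact (lintegral_inv_norm_mul_exp_neg_le hA hν ξ ha).trans_lt ENNReal.ofReal_lt_top

lemma integral_inv_norm_mul_exp_neg_le (hA : 0 < A)
    (hν : ∀ (x : E) (r : ℝ), 0 < r → ν (Metric.ball x r) ≤ ENNReal.ofReal (A * r ^ 2))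
    (ξ : E) {a : ℝ} (ha : 0 < a) :
    ∫ ζ, ‖ξ - ζ‖⁻¹ * Real.exp (-(a * ‖ξ - ζ‖)) ∂ν ≤ A * (4 / a) := by
  rw [integral_eq_lintegral_of_nonneg_ae (ae_of_all _ fun ζ => by positivity)
    (integrable_inv_norm_mul_exp_neg hA hν ξ ha).aestronglyMeasurable]
  exact ENNReal.toReal_le_of_le_ofReal (by positivity)
    (lintegral_inv_norm_mul_exp_neg_le hA hν ξ ha)

end PolarBounds

section KernelBounds

variable {r μ δ : ℝ}

lemma mul_exp_neg_le_one (t : ℝ) : t * Real.exp (-t) ≤ 1 := by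
  have hle : t ≤ Real.exp t := by linarith [Real.add_one_le_exp t]
  calc t * Real.exp (-t) ≤ Real.exp t * Real.exp (-t) := by gcongr
    _ = 1 := by rw [← Real.exp_add]; simp

lemma kernel_le_of_two_mul_le {d : ℝ} (hd : 0 < d) (hr : 2 * d ≤ r) (hμ : 0 < μ)
    (hδ : 0 < δ) (hδ1 : δ ≤ 1) :
    (μ + r⁻¹) * Real.exp (-(μ * δ * r)) ≤ 2 / d * δ⁻¹ * Real.exp (-(d * δ * μ)) := by
  have hexp : Real.exp (-(μ * δ * r)) ≤
      Real.exp (-(d * δ * μ)) * Real.exp (-(d * δ * μ)) := by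
    rw [← Real.exp_add]
    refine Real.exp_le_exp.2 ?_
    nlinarith [mul_le_mul_of_nonneg_left hr (mul_pos hμ hδ).le]
  have hμe : μ * Real.exp (-(d * δ * μ)) ≤ d⁻¹ * δ⁻¹ := by
    have hone := mul_exp_neg_le_one (d * δ * μ)
    calc μ * Real.exp (-(d * δ * μ))
        = d⁻¹ * δ⁻¹ * (d * δ * μ * Real.exp (-(d * δ * μ))) := by field_simp
      _ ≤ d⁻¹ * δ⁻¹ * 1 := by gcongr
      _ = d⁻¹ * δ⁻¹ := mul_one _
  have hre : r⁻¹ * Real.exp (-(d * δ * μ)) ≤ d⁻¹ * δ⁻¹ := by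
    have hrd : r⁻¹ ≤ d⁻¹ := by
      gcongr
      linarith
    have hexp1 : Real.exp (-(d * δ * μ)) ≤ 1 := Real.exp_le_one_iff.2 (by
      have : 0 < d * δ * μ := by positivity
      linarith)
    exact mul_le_mul hrd (hexp1.trans (one_le_inv_iff₀.2 ⟨hδ, hδ1⟩)) (Real.exp_pos _).le
      (by positivity)
  have hr0 : 0 < r := by linarith
  calc (μ + r⁻¹) * Real.exp (-(μ * δ * r))
      ≤ (μ + r⁻¹) * (Real.exp (-(d * δ * μ)) * Real.exp (-(d * δ * μ))) := by gcongr
    _ = (μ * Real.exp (-(d * δ * μ)) + r⁻¹ * Real.exp (-(d * δ * μ))) *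
          Real.exp (-(d * δ * μ)) := by ring
    _ ≤ (d⁻¹ * δ⁻¹ + d⁻¹ * δ⁻¹) * Real.exp (-(d * δ * μ)) := by gcongr
    _ = 2 / d * δ⁻¹ * Real.exp (-(d * δ * μ)) := by ring

lemma kernel_le_inv_mul_exp_neg (hr : 0 < r) (hμ : 0 < μ) (hδ : 0 < δ) (hδ1 : δ ≤ 1) :
    (μ + r⁻¹) * Real.exp (-(μ * δ * r)) ≤
      3 * δ⁻¹ * (r⁻¹ * Real.exp (-(μ * δ / 2 * r))) := by
  have hexp : Real.exp (-(μ * δ * r)) =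
      Real.exp (-(μ * δ / 2 * r)) * Real.exp (-(μ * δ / 2 * r)) := by
    rw [← Real.exp_add]; ring_nf
  have hμe : μ * Real.exp (-(μ * δ / 2 * r)) ≤ 2 * δ⁻¹ * r⁻¹ := by
    have hone := mul_exp_neg_le_one (μ * δ / 2 * r)
    calc μ * Real.exp (-(μ * δ / 2 * r))
        = 2 * δ⁻¹ * r⁻¹ * (μ * δ / 2 * r * Real.exp (-(μ * δ / 2 * r))) := by field_simp
      _ ≤ 2 * δ⁻¹ * r⁻¹ * 1 := by gcongr
      _ = 2 * δ⁻¹ * r⁻¹ := mul_one _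
  have hre : r⁻¹ * Real.exp (-(μ * δ / 2 * r)) ≤ δ⁻¹ * r⁻¹ := by
    have hexp1 : Real.exp (-(μ * δ / 2 * r)) ≤ 1 := Real.exp_le_one_iff.2 (by
      have : 0 < μ * δ / 2 * r := by positivity
      linarith)
    rw [mul_comm]
    gcongr
    exact hexp1.trans (one_le_inv_iff₀.2 ⟨hδ, hδ1⟩)
  calc (μ + r⁻¹) * Real.exp (-(μ * δ * r))
      = (μ * Real.exp (-(μ * δ / 2 * r)) + r⁻¹ * Real.exp (-(μ * δ / 2 * r))) *
          Real.exp (-(μ * δ / 2 * r)) := by rw [hexp]; ring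
    _ ≤ (2 * δ⁻¹ * r⁻¹ + δ⁻¹ * r⁻¹) * Real.exp (-(μ * δ / 2 * r)) := by gcongr
    _ = 3 * δ⁻¹ * (r⁻¹ * Real.exp (-(μ * δ / 2 * r))) := by ring

lemma inv_le_one_add_inv_mul_exp_neg (hr : 0 < r) :
    r⁻¹ ≤ 1 + Real.exp 1 * (r⁻¹ * Real.exp (-(1 * r))) := by
  rcases le_total 1 r with h | h
  · have hinv : r⁻¹ ≤ 1 := inv_le_one_of_one_le₀ h
    have : 0 < Real.exp 1 * (r⁻¹ * Real.exp (-(1 * r))) := by positivity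
    linarith
  · have hexp : 1 ≤ Real.exp 1 * Real.exp (-(1 * r)) := by
      rw [← Real.exp_add]
      exact Real.one_le_exp (by linarith)
    have := mul_le_mul_of_nonneg_left hexp (inv_pos.2 hr).le
    linarith

lemma kernel_le_one_add_inv_mul_exp_neg (hr : 0 < r) (hμ : 0 < μ) (hδ : 0 < δ)
    (hδ1 : δ ≤ 1) :
    (μ + r⁻¹) * Real.exp (-(μ * δ * r)) ≤
      3 * δ⁻¹ * (1 + Real.exp 1 * (r⁻¹ * Real.exp (-(1 * r)))) := by
  refine (kernel_le_inv_mul_exp_neg hr hμ hδ hδ1).trans ?_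
  gcongr
  refine le_trans ?_ (inv_le_one_add_inv_mul_exp_neg hr)
  have : 0 < μ * δ / 2 * r := by positivity
  exact mul_le_of_le_one_right (by positivity) (Real.exp_le_one_iff.2 (by linarith))

end KernelBounds

/-- integral estimates for `(μ + r⁻¹) e^{-μδr}` over a compact surface-like
set, with the constant depending only on `A`, `d₁` and a bound `R` on the diameter. -/
theorem stmt_10 (A d₁ R : ℝ) (hA : 0 < A) (hd₁ : 0 < d₁) (hR : 0 ≤ R) :
    ∃ C : ℝ, 0 < C ∧
      ∀ (L : Set (EuclideanSpace ℝ (Fin 3))) (ν : Measure (EuclideanSpace ℝ (Fin 3))),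
        L.Nonempty → IsCompact L → Metric.diam L ≤ R → ν Lᶜ = 0 →
        (∀ (x : EuclideanSpace ℝ (Fin 3)) (r : ℝ), 0 < r →
          ν (Metric.ball x r) ≤ ENNReal.ofReal (A * r ^ 2)) →
        (∀ ξ : EuclideanSpace ℝ (Fin 3), 2 * d₁ ≤ Metric.infDist ξ L →
          ∀ μ δ : ℝ, 0 < μ → 0 < δ → δ ≤ 1 →
            ∫ ζ in L, (μ + ‖ξ - ζ‖⁻¹) * Real.exp (-(μ * δ * ‖ξ - ζ‖)) ∂ν ≤
              C * δ⁻¹ * Real.exp (-(d₁ * δ * μ))) ∧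
        (∀ (ξ : EuclideanSpace ℝ (Fin 3)) (q : ℝ), q = 0 ∨ q = 1 →
          ∀ μ δ : ℝ, 0 < μ → 0 < δ → δ ≤ 1 →
            ∫ ζ in L, (μ + ‖ξ - ζ‖⁻¹) * Real.exp (-(μ * δ * ‖ξ - ζ‖)) ∂ν ≤
              C * δ ^ (-1 - q) * μ ^ (-q)) := by
  set M : ℝ := A * (R + 1) ^ 2 with hM
  have hM0 : 0 < M := by positivity
  refine ⟨2 / d₁ * M + 3 * (M + Real.exp 1 * (A * 4)) + 24 * A, by positivity, ?_⟩
  intro L ν hLne hL hdiam hsupp hν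
  have hmem : ∀ᵐ ζ ∂ν, ζ ∈ L := hsupp
  rw [Measure.restrict_eq_self_of_ae_mem hmem]
  have hmass : ν Set.univ ≤ ENNReal.ofReal M := by
    obtain ⟨x, hx⟩ := hLne
    have hsub : L ⊆ Metric.ball x (R + 1) := fun y hy => by
      have := Metric.dist_le_diam_of_mem hL.isBounded hy hx
      rw [Metric.mem_ball]
      linarith
    rw [← measure_congr (Filter.eventuallyEq_univ.2 hmem)]
    exact (measure_mono hsub).trans (hν x (R + 1) (by positivity))
  have : IsFiniteMeasure ν := ⟨hmass.trans_lt ENNReal.ofReal_lt_top⟩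
  have hreal : ν.real Set.univ ≤ M := ENNReal.toReal_le_of_le_ofReal hM0.le hmass
  have hnonneg : ∀ (ξ : EuclideanSpace ℝ (Fin 3)) (μ δ : ℝ), 0 < μ →
      0 ≤ᵐ[ν] fun ζ => (μ + ‖ξ - ζ‖⁻¹) * Real.exp (-(μ * δ * ‖ξ - ζ‖)) :=
    fun ξ μ δ hμ => ae_of_all _ fun ζ => by positivity
  refine ⟨fun ξ hξ μ δ hμ hδ hδ1 => ?_, ?_⟩
  · calc ∫ ζ, (μ + ‖ξ - ζ‖⁻¹) * Real.exp (-(μ * δ * ‖ξ - ζ‖)) ∂ν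
        ≤ ∫ _, 2 / d₁ * δ⁻¹ * Real.exp (-(d₁ * δ * μ)) ∂ν := by
          refine integral_mono_of_nonneg (hnonneg ξ μ δ hμ) (integrable_const _) ?_
          filter_upwards [hmem] with ζ hζ
          refine kernel_le_of_two_mul_le hd₁ (hξ.trans ?_) hμ hδ hδ1
          rw [← dist_eq_norm]
          exact Metric.infDist_le_dist_of_mem hζ
      _ = 2 / d₁ * ν.real Set.univ * δ⁻¹ * Real.exp (-(d₁ * δ * μ)) := by
          rw [integral_const, smul_eq_mul]; ring
      _ ≤ _ := by
          gcongr
          have : 2 / d₁ * ν.real Set.univ ≤ 2 / d₁ * M := by gcongr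
          have : 0 < 3 * (M + Real.exp 1 * (A * 4)) + 24 * A := by positivity
          linarith
  · rintro ξ q (rfl | rfl) μ δ hμ hδ hδ1
    · have hint := integrable_inv_norm_mul_exp_neg hA hν ξ one_pos
      have hle := integral_inv_norm_mul_exp_neg_le hA hν ξ one_pos
      calc ∫ ζ, (μ + ‖ξ - ζ‖⁻¹) * Real.exp (-(μ * δ * ‖ξ - ζ‖)) ∂ν
          ≤ ∫ ζ, 3 * δ⁻¹ * (1 + Real.exp 1 *
              (‖ξ - ζ‖⁻¹ * Real.exp (-(1 * ‖ξ - ζ‖)))) ∂ν := by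
            refine integral_mono_of_nonneg (hnonneg ξ μ δ hμ)
              (((integrable_const 1).add (hint.const_mul _)).const_mul _) ?_
            filter_upwards [ae_norm_sub_pos_of_quadratic_growth hν ξ] with ζ hζ
            exact kernel_le_one_add_inv_mul_exp_neg hζ hμ hδ hδ1
        _ = 3 * δ⁻¹ * (ν.real Set.univ + Real.exp 1 *
              ∫ ζ, ‖ξ - ζ‖⁻¹ * Real.exp (-(1 * ‖ξ - ζ‖)) ∂ν) := by
            rw [integral_const_mul, integral_add (integrable_const 1) (hint.const_mul _),
              integral_const_mul, integral_const, smul_eq_mul, mul_one]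
        _ ≤ 3 * δ⁻¹ * (M + Real.exp 1 * (A * (4 / 1))) := by gcongr
        _ = 3 * (M + Real.exp 1 * (A * 4)) * δ⁻¹ := by rw [div_one]; ring
        _ ≤ (2 / d₁ * M + 3 * (M + Real.exp 1 * (A * 4)) + 24 * A) * δ⁻¹ := by
            gcongr
            have : 0 < 2 / d₁ * M := by positivity
            linarith
        _ = _ := by simp [Real.rpow_neg_one]
    · have ha : 0 < μ * δ / 2 := by positivity
      have hint := integrable_inv_norm_mul_exp_neg hA hν ξ ha
      have hle := integral_inv_norm_mul_exp_neg_le hA hν ξ ha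
      calc ∫ ζ, (μ + ‖ξ - ζ‖⁻¹) * Real.exp (-(μ * δ * ‖ξ - ζ‖)) ∂ν
          ≤ ∫ ζ, 3 * δ⁻¹ * (‖ξ - ζ‖⁻¹ * Real.exp (-(μ * δ / 2 * ‖ξ - ζ‖))) ∂ν := by
            refine integral_mono_of_nonneg (hnonneg ξ μ δ hμ) (hint.const_mul _) ?_
            filter_upwards [ae_norm_sub_pos_of_quadratic_growth hν ξ] with ζ hζ
            exact kernel_le_inv_mul_exp_neg hζ hμ hδ hδ1
        _ ≤ 3 * δ⁻¹ * (A * (4 / (μ * δ / 2))) := by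
            rw [integral_const_mul]
            gcongr
        _ = 24 * A * (δ ^ 2)⁻¹ * μ⁻¹ := by field_simp; norm_num
        _ ≤ (2 / d₁ * M + 3 * (M + Real.exp 1 * (A * 4)) + 24 * A) * (δ ^ 2)⁻¹ * μ⁻¹ := by
            gcongr
            have : 0 < 2 / d₁ * M + 3 * (M + Real.exp 1 * (A * 4)) := by positivity
            linarith
        _ = _ := by
            rw [show (-1 - 1 : ℝ) = -((2 : ℕ) : ℝ) by norm_num, Real.rpow_neg hδ.le,
              Real.rpow_natCast, Real.rpow_neg_one]
end

section
/- Let A > 0, d₁ > 0, let L ⊂ ℝ³ be a nonempty compact set, and let ν be a Borel measure on ℝ³ supported in L with ν(B(x, r)) ≤ A·r² for all x ∈ ℝ³ and r > 0. Then there exists a constant C > 0, depending only on A and d₁, such that for every ξ ∈ ℝ³ with dist(ξ, L) ≥ 2·d₁, every ζ ∈ ℝ³, every μ ≥ 1 and every δ ∈ (0,1]: ∫_L (μ + ‖ξ−η‖^{−1})·e^{−μ‖ξ−η‖}·(μ + ‖η−ζ‖^{−1})·e^{−μ‖η−ζ‖} dν(η) ≤ C·δ^{−2}·e^{−2·d₁·δ·μ}·e^{−(1−δ)·μ·‖ξ−ζ‖}.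 -/
open MeasureTheory

open Set Filter Topology Real in
/-- The screened kernel `(a + r⁻¹) e^{-a r}` is the tail integral of minus its derivative. -/
lemma lintegral_Ioi_screened_kernel {a r : ℝ} (ha : 0 < a) (hr : 0 < r) :
    ∫⁻ s in Ioi r, ENNReal.ofReal ((a ^ 2 + a * s⁻¹ + s⁻¹ ^ 2) * exp (-(a * s))) =
      ENNReal.ofReal ((a + r⁻¹) * exp (-(a * r))) := by
  have hexp : Tendsto (fun s : ℝ => exp (-(a * s))) atTop (𝓝 0) :=
    tendsto_exp_neg_atTop_nhds_zero.comp (tendsto_id.const_mul_atTop ha)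
  have hlim : Tendsto (fun s : ℝ => -((a + s⁻¹) * exp (-(a * s)))) atTop (𝓝 0) := by
    simpa using ((tendsto_inv_atTop_zero.const_add a).mul hexp).neg
  have hder : ∀ s ∈ Ici r, HasDerivAt (fun s : ℝ => -((a + s⁻¹) * exp (-(a * s))))
      ((a ^ 2 + a * s⁻¹ + s⁻¹ ^ 2) * exp (-(a * s))) s := by
    intro s hs
    have hs0 : s ≠ 0 := (hr.trans_le hs).ne'
    have h := (((hasDerivAt_inv hs0).const_add a).mul
      ((hasDerivAt_id s).const_mul a).neg.exp).neg
    refine h.congr_deriv ?_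
    simp only [id, Pi.neg_apply]
    field_simp
    ring
  have hpos : ∀ s ∈ Ioi r, 0 ≤ (a ^ 2 + a * s⁻¹ + s⁻¹ ^ 2) * exp (-(a * s)) := by
    intro s hs
    have : 0 < s := hr.trans hs
    positivity
  rw [← ofReal_integral_eq_lintegral_ofReal
      (integrableOn_Ioi_deriv_of_nonneg' hder hpos hlim)
      ((ae_restrict_mem measurableSet_Ioi).mono hpos),
    integral_Ioi_of_hasDerivAt_of_nonneg' hder hpos hlim]
  simp

open Set Filter Topology Real in
lemma lintegral_Ioi_quadratic_mul_exp {a : ℝ} (ha : 0 < a) :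
    ∫⁻ s in Ioi (0 : ℝ), ENNReal.ofReal ((a ^ 2 * s ^ 2 + a * s + 1) * exp (-(a * s))) =
      ENNReal.ofReal (4 / a) := by
  have hmoment (n : ℕ) : Tendsto (fun s : ℝ => s ^ n * exp (-(a * s))) atTop (𝓝 0) := by
    have h := ((tendsto_pow_mul_exp_neg_atTop_nhds_zero n).comp
      (tendsto_id.const_mul_atTop ha)).const_mul ((a ^ n)⁻¹)
    rw [mul_zero] at h
    refine h.congr fun s => ?_
    simp only [Function.comp, id, mul_pow]
    field_simp
  have hlim : Tendsto (fun s : ℝ => -((a * s ^ 2 + 3 * s + 4 / a) * exp (-(a * s))))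
      atTop (𝓝 0) := by
    have h := ((((hmoment 2).const_mul a).add ((hmoment 1).const_mul 3)).add
      ((hmoment 0).const_mul (4 / a))).neg
    simp only [mul_zero, add_zero, neg_zero] at h
    refine h.congr fun s => ?_
    ring
  have hder : ∀ s ∈ Ici (0 : ℝ),
      HasDerivAt (fun s : ℝ => -((a * s ^ 2 + 3 * s + 4 / a) * exp (-(a * s))))
        ((a ^ 2 * s ^ 2 + a * s + 1) * exp (-(a * s))) s := by
    intro s _
    have h := ((((((hasDerivAt_id s).pow 2).const_mul a).add
      ((hasDerivAt_id s).const_mul 3)).add_const (4 / a)).mul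
      ((hasDerivAt_id s).const_mul a).neg.exp).neg
    refine h.congr_deriv ?_
    simp only [id, Pi.neg_apply, Pi.add_apply, Pi.pow_apply]
    field_simp
    ring
  have hpos : ∀ s ∈ Ioi (0 : ℝ), 0 ≤ (a ^ 2 * s ^ 2 + a * s + 1) * exp (-(a * s)) := by
    intro s hs
    have : 0 < s := hs
    positivity
  rw [← ofReal_integral_eq_lintegral_ofReal
      (integrableOn_Ioi_deriv_of_nonneg' hder hpos hlim)
      ((ae_restrict_mem measurableSet_Ioi).mono hpos),
    integral_Ioi_of_hasDerivAt_of_nonneg' hder hpos hlim]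
  simp

open Set Real in
/-- Also valid at `r = 0`, where the convention `0⁻¹ = 0` makes the left-hand side finite. -/
lemma screened_kernel_le_lintegral_Ioi {a r : ℝ} (ha : 0 < a) (hr : 0 ≤ r) :
    ENNReal.ofReal ((a + r⁻¹) * exp (-(a * r))) ≤
      ∫⁻ s in Ioi r, ENNReal.ofReal ((a ^ 2 + a * s⁻¹ + s⁻¹ ^ 2) * exp (-(a * s))) := by
  rcases hr.eq_or_lt with rfl | hr
  · have hr' : 0 < 1 / (2 * a) := by positivity
    refine le_trans ?_ (lintegral_mono_set (Ioi_subset_Ioi hr'.le))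
    rw [lintegral_Ioi_screened_kernel ha hr']
    apply ENNReal.ofReal_le_ofReal
    have harg : a * (1 / (2 * a)) = 1 / 2 := by field_simp
    have hinv : (1 / (2 * a))⁻¹ = 2 * a := by simp
    rw [harg, hinv]
    have := add_one_le_exp (-(1 / 2 : ℝ))
    simp only [inv_zero, mul_zero, neg_zero, exp_zero]
    nlinarith
  · exact (lintegral_Ioi_screened_kernel ha hr).ge

open Set Real in
/-- The integral of the screened kernel against a measure of quadratic growth. -/
lemma lintegral_screened_kernel_le {X : Type*} [PseudoMetricSpace X] [MeasurableSpace X]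
    [OpensMeasurableSpace X] (ν : Measure X) [SFinite ν] {A a : ℝ} (hA : 0 ≤ A) (ha : 0 < a)
    (z : X) (hν : ∀ r : ℝ, 0 < r → ν (Metric.ball z r) ≤ ENNReal.ofReal (A * r ^ 2)) :
    ∫⁻ x, ENNReal.ofReal ((a + (dist x z)⁻¹) * exp (-(a * dist x z))) ∂ν ≤
      ENNReal.ofReal (4 * A / a) := by
  set h : ℝ → ENNReal :=
    fun s => ENNReal.ofReal ((a ^ 2 + a * s⁻¹ + s⁻¹ ^ 2) * exp (-(a * s))) with hh
  have hmeas : Measurable h := by fun_prop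
  set S : Set (X × ℝ) := {p | dist p.1 z < p.2}
  have hSm : MeasurableSet S :=
    measurableSet_lt ((continuous_id.dist continuous_const).measurable.comp measurable_fst) measurable_snd
  set F : X → ℝ → ENNReal := fun x s => S.indicator (fun p => h p.2) (x, s) with hF
  have hFm : Measurable (Function.uncurry F) := (hmeas.comp measurable_snd).indicator hSm
  calc ∫⁻ x, ENNReal.ofReal ((a + (dist x z)⁻¹) * exp (-(a * dist x z))) ∂ν
      ≤ ∫⁻ x, (∫⁻ s in Ioi (0 : ℝ), F x s) ∂ν := by
        refine lintegral_mono fun x => (screened_kernel_le_lintegral_Ioi ha dist_nonneg).trans ?_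
        calc ∫⁻ s in Ioi (dist x z), h s = ∫⁻ s in Ioi (dist x z), F x s := by
              refine setLIntegral_congr_fun measurableSet_Ioi fun s hs => ?_
              have hmem : (x, s) ∈ S := hs
              simp [hF, hmem]
          _ ≤ _ := lintegral_mono_set (Ioi_subset_Ioi dist_nonneg)
    _ = ∫⁻ s in Ioi (0 : ℝ), ∫⁻ x, F x s ∂ν := lintegral_lintegral_swap hFm.aemeasurable
    _ ≤ ∫⁻ s in Ioi (0 : ℝ), ENNReal.ofReal A *
          ENNReal.ofReal ((a ^ 2 * s ^ 2 + a * s + 1) * exp (-(a * s))) := by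
        refine setLIntegral_mono' measurableSet_Ioi fun s hs => ?_
        have hs0 : 0 < s := hs
        have hslice : ∀ x, F x s = (Metric.ball z s).indicator (fun _ => h s) x := fun x => rfl
        simp only [hslice]
        rw [lintegral_indicator_const Metric.isOpen_ball.measurableSet]
        refine (mul_le_mul_right (hν s hs0) _).trans_eq ?_
        rw [hh, ← ENNReal.ofReal_mul (by positivity), ← ENNReal.ofReal_mul hA]
        congr 1
        field_simp
    _ = ENNReal.ofReal (4 * A / a) := by
        rw [lintegral_const_mul' _ _ ENNReal.ofReal_ne_top, lintegral_Ioi_quadratic_mul_exp ha,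
          ← ENNReal.ofReal_mul hA]
        congr 1
        ring

open Real in
/-- Pointwise bound obtained from `p + q ≥ δ D + δ q + (1 - δ) t` when `t ≤ p + q`, `D ≤ p`. -/
lemma screened_kernel_mul_le {D p q t μ δ : ℝ} (hD : 0 < D) (hp : D ≤ p) (hq : 0 ≤ q)
    (ht : t ≤ p + q) (hμ : 1 ≤ μ) (hδ : 0 < δ) (hδ1 : δ ≤ 1) :
    (μ + p⁻¹) * exp (-(μ * p)) * ((μ + q⁻¹) * exp (-(μ * q))) ≤
      ((1 + D⁻¹) * μ * δ⁻¹ * exp (-(D * δ * μ)) * exp (-((1 - δ) * μ * t))) *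
        ((μ * δ + q⁻¹) * exp (-(μ * δ * q))) := by
  have hμ0 : 0 < μ := by linarith
  have hp0 : 0 < p := hD.trans_le hp
  have hfar : μ + p⁻¹ ≤ (1 + D⁻¹) * μ := by
    have h1 : p⁻¹ ≤ D⁻¹ := inv_anti₀ hD hp
    have h2 : 0 < D⁻¹ := by positivity
    nlinarith
  have hnear : μ + q⁻¹ ≤ δ⁻¹ * (μ * δ + q⁻¹) := by
    have h1 : 1 ≤ δ⁻¹ := (one_le_inv₀ hδ).2 hδ1
    have h2 : 0 ≤ q⁻¹ := by positivity
    have h3 : δ⁻¹ * (μ * δ) = μ := by field_simp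
    nlinarith
  have hexp : exp (-(μ * p)) * exp (-(μ * q)) ≤
      exp (-(D * δ * μ)) * exp (-((1 - δ) * μ * t)) * exp (-(μ * δ * q)) := by
    simp only [← exp_add]
    apply exp_le_exp.2
    have h1 : 0 ≤ (1 - δ) * μ * (p + q - t) :=
      mul_nonneg (mul_nonneg (by linarith) hμ0.le) (by linarith)
    have h2 : 0 ≤ δ * μ * (p - D) := mul_nonneg (by positivity) (by linarith)
    linarith
  calc _ = (μ + p⁻¹) * (μ + q⁻¹) * (exp (-(μ * p)) * exp (-(μ * q))) := by ring
    _ ≤ ((1 + D⁻¹) * μ) * (δ⁻¹ * (μ * δ + q⁻¹)) *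
        (exp (-(D * δ * μ)) * exp (-((1 - δ) * μ * t)) * exp (-(μ * δ * q))) := by gcongr
    _ = _ := by ring

/-- composition estimate for two kernels bounded by `(μ + r⁻¹) e^{-μ r}`,
integrated over a distant compact surface-like set. -/
theorem stmt_12 (A d₁ : ℝ) (hA : 0 < A) (hd₁ : 0 < d₁) :
    ∃ C : ℝ, 0 < C ∧
      ∀ (L : Set (EuclideanSpace ℝ (Fin 3))) (ν : Measure (EuclideanSpace ℝ (Fin 3))),
        L.Nonempty → IsCompact L → ν Lᶜ = 0 →
        (∀ (x : EuclideanSpace ℝ (Fin 3)) (r : ℝ), 0 < r →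
          ν (Metric.ball x r) ≤ ENNReal.ofReal (A * r ^ 2)) →
        ∀ ξ : EuclideanSpace ℝ (Fin 3), 2 * d₁ ≤ Metric.infDist ξ L →
        ∀ ζ : EuclideanSpace ℝ (Fin 3), ∀ μ δ : ℝ, 1 ≤ μ → 0 < δ → δ ≤ 1 →
          ∫ η in L, (μ + ‖ξ - η‖⁻¹) * Real.exp (-(μ * ‖ξ - η‖)) *
              ((μ + ‖η - ζ‖⁻¹) * Real.exp (-(μ * ‖η - ζ‖))) ∂ν ≤
            C * δ⁻¹ ^ 2 * Real.exp (-(2 * d₁ * δ * μ)) *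
              Real.exp (-((1 - δ) * μ * ‖ξ - ζ‖)) := by
  refine ⟨4 * A * (1 + (2 * d₁)⁻¹), by positivity, ?_⟩
  intro L ν _ hL _ hν ξ hξ ζ μ δ hμ hδ hδ1
  have hμ0 : 0 < μ := by linarith
  have hfin : IsFiniteMeasure (ν.restrict L) := by
    obtain ⟨R, hR, hsub⟩ := hL.isBounded.subset_ball_lt 0 0
    exact isFiniteMeasure_restrict.2
      (((measure_mono hsub).trans (hν 0 R hR)).trans_lt ENNReal.ofReal_lt_top).ne
  rw [integral_eq_lintegral_of_nonneg_ae (.of_forall fun η => by positivity)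
    (Measurable.aestronglyMeasurable (by fun_prop))]
  refine ENNReal.toReal_le_of_le_ofReal (by positivity) ?_
  set K : ℝ := (1 + (2 * d₁)⁻¹) * μ * δ⁻¹ * Real.exp (-(2 * d₁ * δ * μ)) *
    Real.exp (-((1 - δ) * μ * ‖ξ - ζ‖)) with hK
  have hK0 : 0 ≤ K := by positivity
  calc _ ≤ ∫⁻ η in L, ENNReal.ofReal K * ENNReal.ofReal
        ((μ * δ + (dist η ζ)⁻¹) * Real.exp (-(μ * δ * dist η ζ))) ∂ν := by
        refine setLIntegral_mono' hL.measurableSet fun η hη => ?_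
        rw [← ENNReal.ofReal_mul hK0, dist_eq_norm]
        refine ENNReal.ofReal_le_ofReal (screened_kernel_mul_le (by positivity) ?_
          (norm_nonneg _) (norm_sub_le_norm_sub_add_norm_sub ξ η ζ) hμ hδ hδ1)
        rw [← dist_eq_norm]
        exact hξ.trans (Metric.infDist_le_dist_of_mem hη)
    _ ≤ ENNReal.ofReal K * ENNReal.ofReal (4 * A / (μ * δ)) := by
        rw [lintegral_const_mul' _ _ ENNReal.ofReal_ne_top]
        gcongr
        exact lintegral_screened_kernel_le _ hA.le (by positivity) ζ fun r hr =>
          (Measure.restrict_apply_le _ _).trans (hν ζ r hr)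
    _ = _ := by
        rw [← ENNReal.ofReal_mul hK0, hK]
        congr 1
        field_simp
end

section
/- Let n ≥ 1, let U ⊂ ℝⁿ be a bounded open set containing 0, let τ ∈ ℝ, C₀ > 0, and let S : U → ℝ be measurable with τ ≤ S(σ) ≤ τ + C₀·‖σ‖² for all σ ∈ U. Let c₁ > 0, r₁ > 0 with B(0, r₁) ⊂ U, and let φ : U → ℝ be measurable with 0 ≤ φ ≤ 1 and φ(σ) ≥ c₁ for all σ with ‖σ‖ ≤ r₁. Then there exists a constant C₄ > 0 such that for every τ′ with τ ≤ τ′ ≤ sup_{σ ∈ U} S(σ): ∫_{{σ ∈ U : S(σ) ≤ τ′}} φ(σ) dσ ≥ C₄·(τ′ − τ)^{n/2}. -/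
open MeasureTheory

/-- lower bound for the mass of sublevel sets of a phase with at most
quadratic growth at its minimum point. -/
theorem stmt_15 (n : ℕ) (hn : 1 ≤ n) (U : Set (EuclideanSpace ℝ (Fin n)))
    (hUo : IsOpen U) (hUb : Bornology.IsBounded U)
    (hU0 : (0 : EuclideanSpace ℝ (Fin n)) ∈ U)
    (τ C₀ : ℝ) (hC₀ : 0 < C₀)
    (S : EuclideanSpace ℝ (Fin n) → ℝ) (hSm : Measurable S)
    (hS : ∀ σ ∈ U, τ ≤ S σ ∧ S σ ≤ τ + C₀ * ‖σ‖ ^ 2)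
    (c₁ r₁ : ℝ) (hc₁ : 0 < c₁) (hr₁ : 0 < r₁)
    (hball : Metric.ball (0 : EuclideanSpace ℝ (Fin n)) r₁ ⊆ U)
    (φ : EuclideanSpace ℝ (Fin n) → ℝ) (hφm : Measurable φ)
    (hφ0 : ∀ σ ∈ U, 0 ≤ φ σ) (hφ1 : ∀ σ ∈ U, φ σ ≤ 1)
    (hφc : ∀ σ : EuclideanSpace ℝ (Fin n), ‖σ‖ ≤ r₁ → c₁ ≤ φ σ) :
    ∃ C₄ : ℝ, 0 < C₄ ∧ ∀ τ' : ℝ, τ ≤ τ' → τ' ≤ sSup (S '' U) →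
      C₄ * (τ' - τ) ^ ((n : ℝ) / 2) ≤ ∫ σ in U ∩ {σ | S σ ≤ τ'}, φ σ := by
  obtain ⟨R, hR, hUR⟩ := hUb.exists_pos_norm_le
  set k : ℝ := min 1 (r₁ / R)
  have hk0 : 0 < k := lt_min one_pos (div_pos hr₁ hR)
  set V : ℝ := volume.real (Metric.ball (0 : EuclideanSpace ℝ (Fin n)) 1) with hV
  have hV0 : 0 < V :=
    ENNReal.toReal_pos (Metric.measure_ball_pos _ _ one_pos).ne' measure_ball_lt_top.ne
  refine ⟨c₁ * V * (k / √C₀) ^ n, by positivity, fun τ' hτ hτ' => ?_⟩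
  have hd : 0 ≤ τ' - τ := sub_nonneg.2 hτ
  have hsup : sSup (S '' U) ≤ τ + C₀ * R ^ 2 := by
    refine csSup_le ⟨_, 0, hU0, rfl⟩ ?_
    rintro _ ⟨σ, hσ, rfl⟩
    refine (hS σ hσ).2.trans ?_
    gcongr
    exact hUR σ hσ
  set t : ℝ := √(τ' - τ) / √C₀ with ht
  have ht0 : 0 ≤ t := by positivity
  have htsq : C₀ * t ^ 2 = τ' - τ := by
    rw [ht, div_pow, Real.sq_sqrt hd, Real.sq_sqrt hC₀.le]
    field_simp
  have htR : t ≤ R := by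
    refine le_of_sq_le_sq ?_ hR.le
    refine le_of_mul_le_mul_left ?_ hC₀
    linarith
  have hkt : k * t ≤ t := mul_le_of_le_one_left ht0 (min_le_left _ _)
  have hkr : k * t ≤ r₁ := by
    calc k * t ≤ r₁ / R * R := by
          gcongr
          exact min_le_right _ _
      _ = r₁ := by field_simp
  have hsub : Metric.ball (0 : EuclideanSpace ℝ (Fin n)) (k * t) ⊆ U ∩ {σ | S σ ≤ τ'} := by
    intro σ hσ
    have hσU : σ ∈ U := hball (Metric.ball_subset_ball hkr hσ)
    rw [mem_ball_zero_iff] at hσ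
    refine ⟨hσU, (hS σ hσU).2.trans ?_⟩
    have : C₀ * ‖σ‖ ^ 2 ≤ C₀ * t ^ 2 := by
      gcongr
      exact hσ.le.trans hkt
    linarith
  have hmeas : MeasurableSet (U ∩ {σ | S σ ≤ τ'}) :=
    hUo.measurableSet.inter (measurableSet_le hSm measurable_const)
  have hint : IntegrableOn φ (U ∩ {σ | S σ ≤ τ'}) := by
    refine Measure.integrableOn_of_bounded (M := 1)
      (measure_mono Set.inter_subset_left |>.trans_lt hUb.measure_lt_top).ne
      hφm.aestronglyMeasurable ?_
    filter_upwards [ae_restrict_mem hmeas] with σ hσ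
    rw [Real.norm_of_nonneg (hφ0 σ hσ.1)]
    exact hφ1 σ hσ.1
  have hpow : (τ' - τ) ^ ((n : ℝ) / 2) = √(τ' - τ) ^ n := by
    rw [Real.sqrt_eq_rpow, ← Real.rpow_natCast, ← Real.rpow_mul hd]
    ring_nf
  calc c₁ * V * (k / √C₀) ^ n * (τ' - τ) ^ ((n : ℝ) / 2)
      = c₁ * volume.real (Metric.ball (0 : EuclideanSpace ℝ (Fin n)) (k * t)) := by
        have : NeZero n := ⟨by lia⟩
        rw [measureReal_def, Measure.addHaar_ball _ _ (by positivity), ENNReal.toReal_mul,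
          ENNReal.toReal_ofReal (by positivity), finrank_euclideanSpace_fin, ← measureReal_def,
          ← hV, hpow, mul_assoc, ← mul_pow, ht]
        ring
    _ ≤ ∫ σ in Metric.ball (0 : EuclideanSpace ℝ (Fin n)) (k * t), φ σ := by
        refine setIntegral_ge_of_const_le_real measurableSet_ball measure_ball_lt_top.ne
          (fun σ hσ => hφc σ ?_) (hint.mono_set hsub)
        exact (mem_ball_zero_iff.1 hσ).le.trans hkr
    _ ≤ ∫ σ in U ∩ {σ | S σ ≤ τ'}, φ σ := by
        refine setIntegral_mono_set hint ?_ hsub.eventuallyLE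
        filter_upwards [ae_restrict_mem hmeas] with σ hσ
        exact hφ0 σ hσ.1
end

section
/- Let n ≥ 1, δ₀ ∈ (0,1), and let U ⊂ ℝⁿ be a bounded open set with 0 ∈ U. Let C₀ > 0 and let S : U → ℝ be continuous with S(0) = inf_{σ∈U} S(σ) =: τ₋ and S(σ) ≤ τ₋ + C₀·‖σ‖² for all σ ∈ U. Let φ : ℝⁿ → ℝ be continuous with compact support contained in U, 0 ≤ φ ≤ 1 and φ(0) = 1. Let h₁, h̃₁ : U × ℂ → ℂ be functions such that σ ↦ h₁(σ;λ) and σ ↦ h̃₁(σ;λ) are continuous for each λ, and suppose there are constants C₁, C₁′, μ₀ > 0 with Re h₁(σ;λ) ≥ C₁ and |h₁(σ;λ)| + |h̃₁(σ;λ)| ≤ C₁′ for all σ ∈ U and all λ ∈ C_{δ₀} with Re λ ≥ μ₀. Set h(σ;λ) = h₁(σ;λ) + λ^{−1}·h̃₁(σ;λ) and I(λ) = ∫_U e^{−λ·S(σ)}·φ(σ)·h(σ;λ) dσ. Then there exist constants δ₁ ∈ (0, δ₀], μ₁ ≥ e and C > 0 such that Re( e^{λ·τ₋}·I(λ) ) ≥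 C·(Re λ)^{−n/2} for every λ ∈ Λ_{δ₁} with Re λ ≥ μ₁. -/
open MeasureTheory

/-- Bound on the perturbed amplitude `a + lam⁻¹ * b` when `1 ≤ re lam`. -/
lemma norm_add_inv_mul_le {lam a b : ℂ} {M : ℝ} (hre : 1 ≤ lam.re) (hab : ‖a‖ + ‖b‖ ≤ M) :
    ‖a + lam⁻¹ * b‖ ≤ M := by
  have hlam : 1 ≤ ‖lam‖ := hre.trans (Complex.re_le_norm lam)
  have hinv : ‖lam‖⁻¹ ≤ 1 := inv_le_one_of_one_le₀ hlam
  calc ‖a + lam⁻¹ * b‖ ≤ ‖a‖ + ‖lam‖⁻¹ * ‖b‖ := by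
        simpa only [norm_mul, norm_inv] using norm_add_le a (lam⁻¹ * b)
    _ ≤ ‖a‖ + ‖b‖ := by gcongr; exact mul_le_of_le_one_left (norm_nonneg b) hinv
    _ ≤ M := hab

/-- A small rotation and a small perturbation of the amplitude lose at most half of its
real part. -/
lemma half_le_re_rotation_mul {lam a b : ℂ} {m M θ : ℝ} (hre : 1 ≤ lam.re)
    (ha : m ≤ a.re) (hab : ‖a‖ + ‖b‖ ≤ M) (hθ : |θ| * M ≤ m / 4) (hlam : 4 * M ≤ m * lam.re) :
    m / 2 ≤ (Complex.exp (Complex.I * θ) * (a + lam⁻¹ * b)).re := by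
  have hpos : 0 < lam.re := by linarith
  have hrot : ‖(Complex.exp (Complex.I * θ) - 1) * a‖ ≤ m / 4 := by
    rw [norm_mul]
    have h := Real.norm_exp_I_mul_ofReal_sub_one_le (x := θ)
    rw [Real.norm_eq_abs] at h
    calc _ ≤ |θ| * M := by gcongr; linarith [norm_nonneg b]
      _ ≤ m / 4 := hθ
  have hpert : ‖Complex.exp (Complex.I * θ) * (lam⁻¹ * b)‖ ≤ m / 4 := by
    rw [norm_mul, norm_mul, norm_inv, mul_comm Complex.I, Complex.norm_exp_ofReal_mul_I, one_mul]
    calc ‖lam‖⁻¹ * ‖b‖ ≤ lam.re⁻¹ * M := by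
          gcongr
          · exact Complex.re_le_norm lam
          · linarith [norm_nonneg a]
      _ ≤ m / 4 := by
          rw [inv_mul_le_iff₀ hpos]; linarith
  have hsplit : Complex.exp (Complex.I * θ) * (a + lam⁻¹ * b) =
      a + (Complex.exp (Complex.I * θ) - 1) * a + Complex.exp (Complex.I * θ) * (lam⁻¹ * b) := by
    ring
  rw [hsplit, Complex.add_re, Complex.add_re]
  have h1 := (abs_le.mp ((Complex.abs_re_le_norm _).trans hrot)).1
  have h2 := (abs_le.mp ((Complex.abs_re_le_norm _).trans hpert)).1
  linarith

/-- Pointwise lower bound for a Laplace integrand at height `T` above the minimum of the phase: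
the oscillation is harmless for `T ≤ K * log (re lam) / re lam`, and beyond that height the
integrand is `O((re lam) ^ (-K))`. -/
lemma re_laplace_integrand_ge {lam a b : ℂ} {m M K δ T p : ℝ} (hre : Real.exp 1 ≤ lam.re)
    (hm : 0 < m) (ha : m ≤ a.re) (hab : ‖a‖ + ‖b‖ ≤ M) (hδ : 0 ≤ δ)
    (hδK : δ * K * M ≤ m / 4) (hlam : 4 * M ≤ m * lam.re)
    (him : |lam.im| ≤ δ * lam.re / Real.log lam.re) (hT : 0 ≤ T) (hp0 : 0 ≤ p) (hp1 : p ≤ 1) :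
    m / 2 * (Real.exp (-(lam.re * T)) * p) - 2 * M * lam.re ^ (-K) ≤
      (Complex.exp (-lam * T) * p * (a + lam⁻¹ * b)).re := by
  have hre1 : 1 ≤ lam.re := (Real.one_le_exp zero_le_one).trans hre
  have hpos : 0 < lam.re := by linarith
  have hlog : 1 ≤ Real.log lam.re := (Real.le_log_iff_exp_le hpos).mpr hre
  have hmM : m ≤ M := by
    linarith [norm_nonneg b, Complex.re_le_norm a]
  have hMpos : 0 < M := hm.trans_le hmM
  have hexp : Complex.exp (-lam * T) =
      (Real.exp (-(lam.re * T)) : ℂ) * Complex.exp (Complex.I * (-(lam.im * T) : ℝ)) := by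
    rw [Complex.ofReal_exp, ← Complex.exp_add]
    congr 1
    apply Complex.ext <;> simp
  set E := Real.exp (-(lam.re * T)) with hE
  have hE0 : 0 < E := Real.exp_pos _
  have hfactor : (Complex.exp (-lam * T) * p * (a + lam⁻¹ * b)).re =
      E * p * (Complex.exp (Complex.I * (-(lam.im * T) : ℝ)) * (a + lam⁻¹ * b)).re := by
    rw [hexp, ← Complex.re_ofReal_mul]
    congr 1
    push_cast
    ring
  rw [hfactor]
  have hpow : 0 < lam.re ^ (-K) := Real.rpow_pos_of_pos hpos _
  rcases le_or_gt (lam.re * T) (K * Real.log lam.re) with hle | hgt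
  · have hθ : |(-(lam.im * T))| * M ≤ m / 4 := by
      refine le_trans ?_ hδK
      gcongr
      rw [abs_neg, abs_mul, abs_of_nonneg hT]
      calc |lam.im| * T ≤ δ * lam.re / Real.log lam.re * T := by gcongr
        _ = δ * (lam.re * T / Real.log lam.re) := by ring
        _ ≤ δ * K := by
          gcongr
          rw [div_le_iff₀ (by linarith)]
          exact hle
    have h := half_le_re_rotation_mul hre1 ha hab hθ hlam
    calc _ ≤ E * p * (m / 2) := by nlinarith [mul_pos hMpos hpow]
      _ ≤ _ := by gcongr
  · have hEle : E ≤ lam.re ^ (-K) := by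
      rw [hE, Real.rpow_def_of_pos hpos]
      gcongr
      linarith
    have hnorm : ‖Complex.exp (Complex.I * (-(lam.im * T) : ℝ)) * (a + lam⁻¹ * b)‖ ≤ M := by
      rw [norm_mul, mul_comm Complex.I, Complex.norm_exp_ofReal_mul_I, one_mul]
      exact norm_add_inv_mul_le hre1 hab
    have hge := (abs_le.mp ((Complex.abs_re_le_norm _).trans hnorm)).1
    have hEp : E * p ≤ lam.re ^ (-K) := (mul_le_of_le_one_right hE0.le hp1).trans hEle
    have hEp0 : 0 ≤ E * p := by positivity
    nlinarith [mul_le_mul_of_nonneg_left hge hEp0, mul_le_mul_of_nonneg_left hEp hMpos.le,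
      mul_le_mul_of_nonneg_left hmM hEp0]

/-- A function on `U` that dominates `c * 1_B - ε`, where `B ⊆ U` is the ball of radius `r` around
the origin, has integral at least `c * vol(B) - ε * vol(U)`. -/
lemma ball_sub_le_setIntegral {n : ℕ} {U : Set (EuclideanSpace ℝ (Fin n))} {r c ε : ℝ}
    {g : EuclideanSpace ℝ (Fin n) → ℝ} (hU : MeasurableSet U) (hUfin : volume U ≠ ⊤)
    (hr : 0 < r) (hball : Metric.ball 0 r ⊆ U) (hg : IntegrableOn g U)
    (hle : ∀ σ ∈ U, (Metric.ball 0 r).indicator (fun _ => c) σ - ε ≤ g σ) :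
    c * (r ^ n * volume.real (Metric.ball (0 : EuclideanSpace ℝ (Fin n)) 1))
      - ε * volume.real U ≤ ∫ σ in U, g σ := by
  have hind : IntegrableOn ((Metric.ball (0 : EuclideanSpace ℝ (Fin n)) r).indicator
      fun _ => c) U := (integrableOn_const hUfin).indicator Metric.isOpen_ball.measurableSet
  have hconst : IntegrableOn (fun _ : EuclideanSpace ℝ (Fin n) => ε) U := integrableOn_const hUfin
  have hvol : volume.real (Metric.ball (0 : EuclideanSpace ℝ (Fin n)) r) =
      r ^ n * volume.real (Metric.ball (0 : EuclideanSpace ℝ (Fin n)) 1) := by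
    rw [measureReal_def, Measure.addHaar_ball_of_pos _ _ hr, ENNReal.toReal_mul,
      ENNReal.toReal_ofReal (by positivity), finrank_euclideanSpace_fin, measureReal_def]
  calc _ = ∫ σ in U, ((Metric.ball 0 r).indicator (fun _ => c) σ - ε) := by
        rw [integral_sub hind hconst, setIntegral_indicator Metric.isOpen_ball.measurableSet,
          Set.inter_eq_self_of_subset_right hball, setIntegral_const, setIntegral_const, hvol]
        simp only [smul_eq_mul]
        ring
    _ ≤ _ := setIntegral_mono_on (hind.sub hconst) hg hU hle

/-- lower bound for Laplace integrals with possibly degenerate phase,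
uniformly in the logarithmic sector `Λ_{δ₁}` (Proposition 6.1 of the paper). -/
theorem stmt_16 (n : ℕ) (hn : 1 ≤ n) (δ₀ : ℝ) (hδ₀0 : 0 < δ₀) (hδ₀1 : δ₀ < 1)
    (U : Set (EuclideanSpace ℝ (Fin n))) (hUo : IsOpen U)
    (hUb : Bornology.IsBounded U) (hU0 : (0 : EuclideanSpace ℝ (Fin n)) ∈ U)
    (C₀ : ℝ) (hC₀ : 0 < C₀)
    (S : EuclideanSpace ℝ (Fin n) → ℝ) (hScont : ContinuousOn S U)
    (τ : ℝ) (hS0 : S 0 = τ)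
    (hSlow : ∀ σ ∈ U, τ ≤ S σ) (hSquad : ∀ σ ∈ U, S σ ≤ τ + C₀ * ‖σ‖ ^ 2)
    (φ : EuclideanSpace ℝ (Fin n) → ℝ) (hφcont : Continuous φ)
    (hφsupp : HasCompactSupport φ) (hφU : tsupport φ ⊆ U)
    (hφ0 : ∀ σ, 0 ≤ φ σ) (hφ1 : ∀ σ, φ σ ≤ 1) (hφat0 : φ 0 = 1)
    (h₁ ht₁ : EuclideanSpace ℝ (Fin n) → ℂ → ℂ)
    (hc1 : ∀ lam : ℂ, ContinuousOn (fun σ => h₁ σ lam) U)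
    (hc2 : ∀ lam : ℂ, ContinuousOn (fun σ => ht₁ σ lam) U)
    (C₁ C₁' μ₀ : ℝ) (hC₁ : 0 < C₁) (hC₁' : 0 < C₁') (hμ₀ : 0 < μ₀)
    (hlow : ∀ σ ∈ U, ∀ lam : ℂ, δ₀ * |lam.im| ≤ lam.re → μ₀ ≤ lam.re →
      C₁ ≤ (h₁ σ lam).re)
    (hup : ∀ σ ∈ U, ∀ lam : ℂ, δ₀ * |lam.im| ≤ lam.re → μ₀ ≤ lam.re →
      ‖h₁ σ lam‖ + ‖ht₁ σ lam‖ ≤ C₁') :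
    ∃ δ₁ : ℝ, 0 < δ₁ ∧ δ₁ ≤ δ₀ ∧ ∃ μ₁ : ℝ, Real.exp 1 ≤ μ₁ ∧ ∃ C : ℝ, 0 < C ∧
      ∀ lam : ℂ, Real.exp 1 ≤ lam.re →
        |lam.im| ≤ δ₁ * lam.re / Real.log lam.re → μ₁ ≤ lam.re →
        C * lam.re ^ (-(n : ℝ) / 2) ≤
          (Complex.exp (lam * (τ : ℂ)) *
            ∫ σ in U, Complex.exp (-lam * (S σ : ℂ)) * (φ σ : ℂ) *
              (h₁ σ lam + lam⁻¹ * ht₁ σ lam)).re := by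
  obtain ⟨ρ, hρ, hρU, hρφ⟩ : ∃ ρ : ℝ, 0 < ρ ∧
      Metric.ball (0 : EuclideanSpace ℝ (Fin n)) ρ ⊆ U ∧
      ∀ σ ∈ Metric.ball (0 : EuclideanSpace ℝ (Fin n)) ρ, 1 / 2 < φ σ := by
    have hnhds : U ∩ {σ | 1 / 2 < φ σ} ∈ nhds (0 : EuclideanSpace ℝ (Fin n)) :=
      Filter.inter_mem (hUo.mem_nhds hU0)
        ((isOpen_lt continuous_const hφcont).mem_nhds (by simp [hφat0]; norm_num))
    obtain ⟨ρ, hρ, hsub⟩ := Metric.mem_nhds_iff.mp hnhds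
    exact ⟨ρ, hρ, fun σ hσ => (hsub hσ).1, fun σ hσ => (hsub hσ).2⟩
  have hUfin : volume U ≠ ⊤ := hUb.measure_lt_top.ne
  have hUm : MeasurableSet U := hUo.measurableSet
  set V := volume.real U with hV
  set B := volume.real (Metric.ball (0 : EuclideanSpace ℝ (Fin n)) 1) with hB
  have hBpos : 0 < B :=
    ENNReal.toReal_pos (Metric.measure_ball_pos volume _ one_pos).ne' measure_ball_lt_top.ne
  have hV0 : 0 ≤ V := measureReal_nonneg
  set K : ℝ := n / 2 + 1 with hK
  have hKpos : 0 < K := by positivity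
  set c : ℝ := C₁ / 2 * (Real.exp (-(C₀ * ρ ^ 2)) * (1 / 2)) with hc
  have hcpos : 0 < c := by positivity
  set D : ℝ := c * (ρ ^ n * B) with hD
  have hDpos : 0 < D := by positivity
  refine ⟨min δ₀ (C₁ / (4 * (K * C₁'))), by positivity, min_le_left _ _,
    max (Real.exp 1) (max μ₀ (max (4 * C₁' / C₁) (2 * (2 * C₁' * V) / D))), le_max_left _ _,
    D / 2, by positivity, ?_⟩
  intro lam hre him hμ
  simp only [max_le_iff] at hμ
  obtain ⟨-, hμ₀le, hμC, hμV⟩ := hμ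
  rw [div_le_iff₀ hC₁] at hμC
  rw [div_le_iff₀ hDpos] at hμV
  set δ₁ := min δ₀ (C₁ / (4 * (K * C₁'))) with hδ₁
  have hδ₁0 : 0 < δ₁ := by positivity
  have hδ₁K : δ₁ * K * C₁' ≤ C₁ / 4 := by
    have h : δ₁ ≤ C₁ / (4 * (K * C₁')) := min_le_right _ _
    rw [le_div_iff₀ (by positivity)] at h
    linarith
  have hre1 : 1 ≤ lam.re := (Real.one_le_exp zero_le_one).trans hre
  have hpos : 0 < lam.re := by linarith
  have hlog : 1 ≤ Real.log lam.re := (Real.le_log_iff_exp_le hpos).mpr hre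
  have hsector : δ₀ * |lam.im| ≤ lam.re := by
    have hδ₁1 : δ₁ ≤ 1 := (min_le_left _ _).trans hδ₀1.le
    have h1 : |lam.im| ≤ lam.re := by
      refine him.trans ((div_le_self (by positivity) hlog).trans ?_)
      exact mul_le_of_le_one_left hpos.le hδ₁1
    exact (mul_le_of_le_one_left (abs_nonneg _) hδ₀1.le).trans h1
  set f : EuclideanSpace ℝ (Fin n) → ℂ := fun σ =>
    Complex.exp (-lam * ((S σ - τ : ℝ) : ℂ)) * (φ σ : ℂ) * (h₁ σ lam + lam⁻¹ * ht₁ σ lam) with hf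
  have hshift : Complex.exp (lam * (τ : ℂ)) * ∫ σ in U, Complex.exp (-lam * (S σ : ℂ)) *
      (φ σ : ℂ) * (h₁ σ lam + lam⁻¹ * ht₁ σ lam) = ∫ σ in U, f σ := by
    rw [← integral_const_mul]
    congr 1
    funext σ
    simp only [hf]
    rw [← mul_assoc, ← mul_assoc, ← Complex.exp_add]
    congr 3
    push_cast
    ring
  have hfcont : ContinuousOn f U := by
    have h1 := hc1 lam
    have h2 := hc2 lam
    have h3 := hφcont.continuousOn (s := U)
    simp only [hf]
    fun_prop
  have hfint : IntegrableOn f U := by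
    refine IntegrableOn.of_bound hUb.measure_lt_top (hfcont.aestronglyMeasurable hUm) C₁' ?_
    refine (ae_restrict_iff' hUm).mpr (Filter.Eventually.of_forall fun σ hσ => ?_)
    have hexp : ‖Complex.exp (-lam * ((S σ - τ : ℝ) : ℂ))‖ ≤ 1 := by
      rw [Complex.norm_exp, Real.exp_le_one_iff, Complex.re_mul_ofReal, Complex.neg_re]
      have := hSlow σ hσ
      nlinarith
    have hφn : ‖(φ σ : ℂ)‖ ≤ 1 := by
      rw [Complex.norm_real, Real.norm_of_nonneg (hφ0 σ)]
      exact hφ1 σ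
    have hh := norm_add_inv_mul_le hre1 (hup σ hσ lam hsector hμ₀le)
    calc ‖f σ‖ ≤ 1 * 1 * C₁' := by
          simp only [hf, norm_mul]
          gcongr
      _ = C₁' := by ring
  have hre_int : (∫ σ in U, f σ).re = ∫ σ in U, (f σ).re :=
    (Complex.reCLM.integral_comp_comm hfint).symm
  rw [hshift, hre_int]
  have hr0 : 0 < ρ / √lam.re := by positivity
  have hrle : ρ / √lam.re ≤ ρ := div_le_self hρ.le (Real.one_le_sqrt.mpr hre1)
  have hlower := ball_sub_le_setIntegral (c := c) (ε := 2 * C₁' * lam.re ^ (-K)) hUm hUfin hr0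
    ((Metric.ball_subset_ball hrle).trans hρU) (Complex.reCLM.integrable_comp hfint)
    (fun σ hσ => by
      have hT : 0 ≤ S σ - τ := sub_nonneg.mpr (hSlow σ hσ)
      refine le_trans ?_ (re_laplace_integrand_ge (K := K) hre hC₁ (hlow σ hσ lam hsector hμ₀le)
        (hup σ hσ lam hsector hμ₀le) hδ₁0.le hδ₁K (by linarith) him hT (hφ0 σ) (hφ1 σ))
      gcongr
      have hφσ := hφ0 σ
      refine Set.indicator_apply_le' (fun hσr => ?_) (fun _ => by positivity)
      have hquad : lam.re * (S σ - τ) ≤ C₀ * ρ ^ 2 := by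
        have hnorm : ‖σ‖ ≤ ρ / √lam.re := (mem_ball_zero_iff.mp hσr).le
        have hsq : ‖σ‖ ^ 2 ≤ ρ ^ 2 / lam.re := by
          calc ‖σ‖ ^ 2 ≤ (ρ / √lam.re) ^ 2 := by gcongr
            _ = ρ ^ 2 / lam.re := by rw [div_pow, Real.sq_sqrt hpos.le]
        calc lam.re * (S σ - τ) ≤ lam.re * (C₀ * (ρ ^ 2 / lam.re)) := by
              gcongr
              nlinarith [hSquad σ hσ]
          _ = C₀ * ρ ^ 2 := by field_simp
      have hφhalf := (hρφ σ (Metric.ball_subset_ball hrle hσr)).le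
      rw [hc]
      gcongr)
  refine le_trans ?_ hlower
  have hsqrt : (ρ / √lam.re) ^ n = ρ ^ n * lam.re ^ (-(n : ℝ) / 2) := by
    rw [div_pow, Real.sqrt_eq_rpow, ← Real.rpow_mul_natCast hpos.le, div_eq_mul_inv,
      ← Real.rpow_neg hpos.le]
    congr 2
    ring
  have hKpow : lam.re ^ (-K) = lam.re ^ (-(n : ℝ) / 2) * lam.re⁻¹ := by
    rw [← Real.rpow_neg_one, ← Real.rpow_add hpos]
    congr 1
    rw [hK]
    ring
  rw [hsqrt, hKpow, ← hB, ← hV]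
  have hP : 0 < lam.re ^ (-(n : ℝ) / 2) := Real.rpow_pos_of_pos hpos _
  have hsmall : 2 * C₁' * V * lam.re⁻¹ ≤ D / 2 := by
    rw [← div_eq_mul_inv, div_le_iff₀ hpos]
    linarith
  calc D / 2 * lam.re ^ (-(n : ℝ) / 2)
      ≤ (D - 2 * C₁' * V * lam.re⁻¹) * lam.re ^ (-(n : ℝ) / 2) := by
        gcongr
        linarith
    _ = _ := by rw [hD]; ring
end

section
/- Let n ≥ 1, δ₀ ∈ (0,1), and let U ⊂ ℝⁿ be a bounded open set with 0 ∈ U. Let S : U → ℝ be a C² function with S(0) = τ₋, ∇S(0) = 0, S(σ) > τ₋ for all σ ∈ U with σ ≠ 0, whose Hessian matrix A = (∂²S/∂σᵢ∂σⱼ (0)) is positive definite, and which satisfies S(σ) ≥ τ₋ + C₀′·‖σ‖² on U for some C₀′ > 0. Let φ : ℝⁿ → ℝ be continuous with compact support contained in U, 0 ≤ φ ≤ 1 and φ(0) = 1. Let μ₀ > 0 and let h : U × ℂ → ℂ be such that σ ↦ h(σ;λ) is continuous for each λ, sup{ |h(σ;λ)| : σ ∈ U, λ ∈ C_{δ₀},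 Re λ ≥ μ₀ } < ∞, and h(σ;λ) → h(0;λ) as σ → 0 uniformly in λ ∈ C_{δ₀} with Re λ ≥ μ₀. Set I(λ) = ∫_U e^{−λ·S(σ)}·φ(σ)·h(σ;λ) dσ. Then for every ε > 0 there exists μ₁ ≥ μ₀ such that for all λ ∈ C_{δ₀} with Re λ ≥ μ₁: | λ^{n/2}·e^{λ·τ₋}·I(λ) − (2π)^{n/2}·(det A)^{−1/2}·h(0;λ) | ≤ ε, where λ^{n/2} = exp((n/2)·Log λ) with the principal logarithm. -/
open MeasureTheory

theorem Complex.norm_exp_neg_mul_sub_exp_neg_mul_le {z : ℂ} (hz : 0 ≤ z.re) {a b m : ℝ}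
    (ha : m ≤ a) (hb : m ≤ b) :
    ‖exp (-z * a) - exp (-z * b)‖ ≤ ‖z‖ * |a - b| * Real.exp (-(z.re * m)) := by
  have key := (convex_halfSpace_re_le (-(z.re * m))).norm_image_sub_le_of_norm_hasDerivWithin_le
    (f := exp) (f' := exp) (C := Real.exp (-(z.re * m))) (x := -z * b) (y := -z * a)
    (fun w _ => (hasDerivAt_exp w).hasDerivWithinAt)
    (fun w hw => by rw [norm_exp]; exact Real.exp_le_exp.2 hw)
    (by simpa using mul_le_mul_of_nonneg_left hb hz)
    (by simpa using mul_le_mul_of_nonneg_left ha hz)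
  have hab : ‖-z * a - -z * b‖ = ‖z‖ * |a - b| := by
    rw [← mul_sub, norm_mul, norm_neg, ← ofReal_sub, norm_real, Real.norm_eq_abs]
  rw [hab] at key
  linarith

theorem Real.mul_exp_neg_mul_le {c : ℝ} (hc : 0 < c) (x : ℝ) :
    x * exp (-(c * x)) ≤ 2 / c * exp (-(c * x / 2)) := by
  have h1 : c * x / 2 ≤ exp (c * x / 2) := by linarith [add_one_le_exp (c * x / 2)]
  have h2 : x ≤ 2 / c * exp (c * x / 2) := by
    calc x = 2 / c * (c * x / 2) := by field_simp
      _ ≤ _ := by gcongr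
  calc x * exp (-(c * x)) ≤ 2 / c * exp (c * x / 2) * exp (-(c * x)) := by gcongr
    _ = _ := by rw [mul_assoc, ← exp_add]; ring_nf

/-- Second order Taylor expansion at a critical point. -/
theorem ContDiffAt.exists_abs_sub_half_snd_fderiv_le {E : Type*} [NormedAddCommGroup E]
    [NormedSpace ℝ E] {f : E → ℝ} (hf : ContDiffAt ℝ 2 f 0) (hcrit : fderiv ℝ f 0 = 0)
    {η : ℝ} (hη : 0 < η) :
    ∃ δ > 0, ∀ x, ‖x‖ < δ →
      |f x - f 0 - 1 / 2 * fderiv ℝ (fderiv ℝ f) 0 x x| ≤ η * ‖x‖ ^ 2 := by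
  set D := fderiv ℝ (fderiv ℝ f) 0 with hD
  have hsymm : ∀ v w, D v w = D w v := hf.isSymmSndFDerivAt (by simp)
  have hD' : HasFDerivAt (fderiv ℝ f) D 0 :=
    ((hf.fderiv_right (m := 1) (by norm_num)).differentiableAt (by simp)).hasFDerivAt
  have hlin := hD'.isLittleO.def hη
  have hdiff : ∀ᶠ x in nhds (0 : E), DifferentiableAt ℝ f x := by
    filter_upwards [hf.eventually (by simp)] with x hx using hx.differentiableAt (by simp)
  obtain ⟨δ, hδ, hball⟩ := Metric.eventually_nhds_iff.1 (hlin.and hdiff)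
  refine ⟨δ, hδ, fun x hx => ?_⟩
  have hq : ∀ y, HasFDerivAt (fun y => 1 / 2 * D y y) (D y) y := by
    intro y
    have := ((D.hasFDerivAt (x := y)).clm_apply (hasFDerivAt_id y)).const_mul (1 / 2 : ℝ)
    refine this.congr_fderiv ?_
    ext v
    simp [hsymm v y]
    ring
  have hmem : ∀ y ∈ Metric.closedBall (0 : E) ‖x‖, y ∈ Metric.ball (0 : E) δ :=
    fun y hy => lt_of_le_of_lt hy hx
  have key := (convex_closedBall (0 : E) ‖x‖).norm_image_sub_le_of_norm_hasFDerivWithin_le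
    (f := fun y => f y - 1 / 2 * D y y) (f' := fun y => fderiv ℝ f y - D y) (C := η * ‖x‖)
    (x := 0) (y := x)
    (fun y hy => ((hball (hmem y hy)).2.hasFDerivAt.sub (hq y)).hasFDerivWithinAt)
    (fun y hy => by
      have h1 := (hball (hmem y hy)).1
      simp only [hcrit, sub_zero] at h1
      refine h1.trans ?_
      gcongr
      simpa using hy)
    (by simp) (by simp)
  simp only [map_zero, mul_zero, sub_zero, Real.norm_eq_abs] at key
  calc |f x - f 0 - 1 / 2 * D x x| = |f x - 1 / 2 * D x x - f 0| := by ring_nf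
    _ ≤ η * ‖x‖ * ‖x‖ := key
    _ = η * ‖x‖ ^ 2 := by ring

section Gaussian

variable {E : Type*} [NormedAddCommGroup E] [InnerProductSpace ℝ E] [FiniteDimensional ℝ E]
  [MeasurableSpace E] [BorelSpace E]

theorem integral_comp_linearMap_of_det_ne_zero {L : E →ₗ[ℝ] E} (hL : LinearMap.det L ≠ 0)
    (f : E → ℂ) (hf : Continuous f) :
    ∫ x, f (L x) = ((|LinearMap.det L|⁻¹ : ℝ) : ℂ) * ∫ x, f x := by
  have hmeas : AEMeasurable L (volume : Measure E) :=
    L.continuous_of_finiteDimensional.aemeasurable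
  rw [← integral_map hmeas hf.aestronglyMeasurable,
    Measure.map_linearMap_addHaar_eq_smul_addHaar _ hL, integral_smul_measure,
    ENNReal.toReal_ofReal (abs_nonneg _), abs_inv, Complex.real_smul]

theorem cpow_mul_integral_cexp_neg_mul_half_norm_sq {L : E →ₗ[ℝ] E}
    (hL : LinearMap.det L ≠ 0) {z : ℂ} (hz : 0 < z.re) :
    Complex.exp ((Module.finrank ℝ E : ℂ) / 2 * Complex.log z) *
        ∫ x, Complex.exp (-z * ((1 / 2 * ‖L x‖ ^ 2 : ℝ) : ℂ)) =
      (((2 * Real.pi) ^ ((Module.finrank ℝ E : ℝ) / 2) / |LinearMap.det L| : ℝ) : ℂ) := by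
  have hz0 : z ≠ 0 := by rintro rfl; simp at hz
  have harg : z.arg ≠ Real.pi := by
    intro h
    have := (Complex.arg_eq_pi_iff.1 h).1
    linarith
  have hpi : (0 : ℝ) < 2 * Real.pi := by positivity
  have hint := integral_comp_linearMap_of_det_ne_zero hL
    (fun y : E => Complex.exp (-(z / 2) * (‖y‖ : ℂ) ^ 2)) (by fun_prop)
  have hgauss := GaussianFourier.integral_cexp_neg_mul_sq_norm (b := z / 2) (V := E)
    (by simpa using hz)
  have hcongr : (fun x => Complex.exp (-z * ((1 / 2 * ‖L x‖ ^ 2 : ℝ) : ℂ))) =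
      fun x => Complex.exp (-(z / 2) * (‖L x‖ : ℂ) ^ 2) := by
    funext x
    congr 1
    push_cast
    ring
  have hdiv : (Real.pi : ℂ) / (z / 2) = ((2 * Real.pi : ℝ) : ℂ) * z⁻¹ := by
    push_cast
    field_simp
  have hne : ((2 * Real.pi : ℝ) : ℂ) * z⁻¹ ≠ 0 :=
    mul_ne_zero (Complex.ofReal_ne_zero.2 hpi.ne') (inv_ne_zero hz0)
  rw [hcongr, hint, hgauss, hdiv, Complex.cpow_def_of_ne_zero hne,
    Complex.log_ofReal_mul hpi (inv_ne_zero hz0), Complex.log_inv _ harg, mul_left_comm,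
    ← Complex.exp_add, Real.rpow_def_of_pos hpi, div_eq_inv_mul _ |LinearMap.det L|, Complex.ofReal_mul,
    Complex.ofReal_exp]
  congr 2
  push_cast
  ring

theorem integrable_rexp_neg_mul_norm_sq {b : ℝ} (hb : 0 < b) :
    Integrable fun x : E => Real.exp (-b * ‖x‖ ^ 2) := by
  have := (GaussianFourier.integrable_cexp_neg_mul_sq_norm_add (b := (b : ℂ)) (V := E)
    (by simpa using hb) 0 0).norm
  refine this.congr (Filter.Eventually.of_forall fun x => ?_)
  simp only [Complex.norm_exp]
  congr 1
  norm_cast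
  simp

/-- Quantitative comparison of a Laplace integral with its Gaussian model. -/
theorem norm_setIntegral_laplace_sub_gaussian_le {U : Set E} (hU : MeasurableSet U)
    {S Q : E → ℝ} {g : E → ℂ} {g₀ z : ℂ} {c M K η δ : ℝ}
    (hc : 0 < c) (hM : 0 ≤ M) (hK : 0 ≤ K) (hη : 0 ≤ η) (hδ : 0 < δ)
    (hz : 0 < z.re) (hzK : ‖z‖ ≤ K * z.re)
    (hS : ContinuousOn S U) (hg : ContinuousOn g U) (hQ : Continuous Q)
    (hScoer : ∀ x ∈ U, c * ‖x‖ ^ 2 ≤ S x) (hQcoer : ∀ x, c * ‖x‖ ^ 2 ≤ Q x)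
    (hgM : ∀ x ∈ U, ‖g x‖ ≤ M) (hg₀ : ‖g₀‖ ≤ M)
    (hnear : ∀ x, ‖x‖ < δ → x ∈ U ∧ |S x - Q x| ≤ η * ‖x‖ ^ 2 ∧ ‖g x - g₀‖ ≤ η) :
    ‖(∫ x in U, Complex.exp (-z * S x) * g x) - (∫ x, Complex.exp (-z * Q x)) * g₀‖ ≤
      (η * (1 + 2 * M * K / c) + 4 * M / (c * δ ^ 2 * z.re)) *
        (2 * Real.pi / (c * z.re)) ^ ((Module.finrank ℝ E : ℝ) / 2) := by
  set B : ℝ := η * (1 + 2 * M * K / c) + 4 * M / (c * δ ^ 2 * z.re) with hB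
  have hexp : ∀ {t : ℝ} {x : E}, c * ‖x‖ ^ 2 ≤ t →
      ‖Complex.exp (-z * t)‖ ≤ Real.exp (-(c * (z.re * ‖x‖ ^ 2))) := by
    intro t x ht
    rw [Complex.norm_exp, Real.exp_le_exp]
    simp only [Complex.mul_re, Complex.neg_re, Complex.ofReal_re, Complex.ofReal_im, mul_zero,
      sub_zero]
    nlinarith [mul_le_mul_of_nonneg_left ht hz.le]
  have hgaussian : Integrable fun x : E => Real.exp (-(c * z.re) * ‖x‖ ^ 2) :=
    integrable_rexp_neg_mul_norm_sq (by positivity)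
  have hexponent : ∀ x : E, -(c * z.re) * ‖x‖ ^ 2 = -(c * (z.re * ‖x‖ ^ 2)) := fun x => by ring
  have hint₁ : IntegrableOn (fun x => Complex.exp (-z * S x) * g x) U := by
    refine (hgaussian.mul_const M).integrableOn.mono' ?_ ?_
    · refine ContinuousOn.aestronglyMeasurable ?_ hU
      exact (Complex.continuous_exp.comp_continuousOn
        (continuousOn_const.mul (Complex.continuous_ofReal.comp_continuousOn hS))).mul hg
    · filter_upwards [ae_restrict_mem hU] with x hx
      rw [norm_mul, hexponent]
      exact mul_le_mul (hexp (hScoer x hx)) (hgM x hx) (norm_nonneg _) (Real.exp_pos _).le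
  have hint₂ : Integrable fun x => Complex.exp (-z * Q x) := by
    refine hgaussian.mono' (by fun_prop) (Filter.Eventually.of_forall fun x => ?_)
    rw [hexponent]
    exact hexp (hQcoer x)
  have hbound : ∀ x, ‖U.indicator (fun x => Complex.exp (-z * S x) * g x) x -
      Complex.exp (-z * Q x) * g₀‖ ≤ B * Real.exp (-(c * z.re / 2) * ‖x‖ ^ 2) := by
    intro x
    have hlin := Real.mul_exp_neg_mul_le hc (z.re * ‖x‖ ^ 2)
    have hexponent' : -(c * z.re / 2) * ‖x‖ ^ 2 = -(c * (z.re * ‖x‖ ^ 2) / 2) := by ring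
    rw [hexponent']
    set e₁ := Real.exp (-(c * (z.re * ‖x‖ ^ 2))) with he₁
    set e₂ := Real.exp (-(c * (z.re * ‖x‖ ^ 2) / 2)) with he₂
    have he₁₂ : e₁ ≤ e₂ := Real.exp_le_exp.2 (by
      have : 0 ≤ c * (z.re * ‖x‖ ^ 2) := by positivity
      linarith)
    have he₁0 : 0 ≤ e₁ := (Real.exp_pos _).le
    have he₂0 : 0 ≤ e₂ := (Real.exp_pos _).le
    by_cases hx : ‖x‖ < δ
    · obtain ⟨hxU, hSQ, hgg⟩ := hnear x hx
      rw [Set.indicator_of_mem hxU]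
      have hdiff := Complex.norm_exp_neg_mul_sub_exp_neg_mul_le hz.le (hScoer x hxU) (hQcoer x)
      have hexp_eq : Real.exp (-(z.re * (c * ‖x‖ ^ 2))) = e₁ := by rw [he₁]; ring_nf
      rw [hexp_eq] at hdiff
      have hdiff' : ‖Complex.exp (-z * S x) - Complex.exp (-z * Q x)‖ ≤
          K * η * (2 / c) * e₂ := by
        calc _ ≤ ‖z‖ * |S x - Q x| * e₁ := hdiff
          _ ≤ (K * z.re) * (η * ‖x‖ ^ 2) * e₁ := by gcongr
          _ = K * η * (z.re * ‖x‖ ^ 2 * e₁) := by ring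
          _ ≤ K * η * (2 / c * e₂) := by gcongr
          _ = _ := by ring
      calc ‖Complex.exp (-z * S x) * g x - Complex.exp (-z * Q x) * g₀‖
          = ‖Complex.exp (-z * S x) * (g x - g₀) +
              (Complex.exp (-z * S x) - Complex.exp (-z * Q x)) * g₀‖ := by ring_nf
        _ ≤ ‖Complex.exp (-z * S x)‖ * ‖g x - g₀‖ +
              ‖Complex.exp (-z * S x) - Complex.exp (-z * Q x)‖ * ‖g₀‖ := by
            refine (norm_add_le _ _).trans_eq ?_
            rw [norm_mul, norm_mul]
        _ ≤ e₂ * η + K * η * (2 / c) * e₂ * M := by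
            gcongr
            exact (hexp (hScoer x hxU)).trans he₁₂
        _ = η * (1 + 2 * M * K / c) * e₂ := by ring
        _ ≤ B * e₂ := by
            gcongr
            rw [hB]
            exact le_add_of_nonneg_right (by positivity)
    · have hfirst : ‖U.indicator (fun x => Complex.exp (-z * S x) * g x) x‖ ≤ e₁ * M := by
        by_cases hxU : x ∈ U
        · rw [Set.indicator_of_mem hxU, norm_mul]
          exact mul_le_mul (hexp (hScoer x hxU)) (hgM x hxU) (norm_nonneg _) he₁0
        · rw [Set.indicator_of_notMem hxU, norm_zero]
          positivity
      have hsecond : ‖Complex.exp (-z * Q x) * g₀‖ ≤ e₁ * M := by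
        rw [norm_mul]
        exact mul_le_mul (hexp (hQcoer x)) hg₀ (norm_nonneg _) he₁0
      have hone : 1 ≤ ‖x‖ ^ 2 / δ ^ 2 := by
        rw [one_le_div (by positivity)]
        exact pow_le_pow_left₀ hδ.le (not_lt.1 hx) 2
      calc _ ≤ e₁ * M + e₁ * M := (norm_sub_le _ _).trans (add_le_add hfirst hsecond)
        _ = 2 * M * e₁ * 1 := by ring
        _ ≤ 2 * M * e₁ * (‖x‖ ^ 2 / δ ^ 2) := by gcongr
        _ = 2 * M / (δ ^ 2 * z.re) * (z.re * ‖x‖ ^ 2 * e₁) := by field_simp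
        _ ≤ 2 * M / (δ ^ 2 * z.re) * (2 / c * e₂) := by gcongr
        _ = 4 * M / (c * δ ^ 2 * z.re) * e₂ := by field_simp; ring
        _ ≤ B * e₂ := by
            gcongr
            rw [hB]
            exact le_add_of_nonneg_left (by positivity)
  rw [← integral_indicator hU, ← integral_mul_const,
    ← integral_sub (hint₁.integrable_indicator hU) (hint₂.mul_const _)]
  refine (norm_integral_le_of_norm_le ((integrable_rexp_neg_mul_norm_sq (by positivity)).const_mul B)
    (Filter.Eventually.of_forall hbound)).trans_eq ?_
  rw [integral_const_mul, GaussianFourier.integral_rexp_neg_mul_sq_norm (by positivity)]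
  congr 2
  field_simp

end Gaussian

open scoped MatrixOrder ComplexOrder in
/-- A positive definite bilinear form is the square of the norm of an invertible linear map. -/
theorem Matrix.PosDef.exists_norm_sq_eq {n : ℕ} {A : Matrix (Fin n) (Fin n) ℝ} (hA : A.PosDef)
    (D : EuclideanSpace ℝ (Fin n) →L[ℝ] EuclideanSpace ℝ (Fin n) →L[ℝ] ℝ)
    (hAD : ∀ i j, A i j = D (EuclideanSpace.single i 1) (EuclideanSpace.single j 1)) :
    ∃ L : EuclideanSpace ℝ (Fin n) →ₗ[ℝ] EuclideanSpace ℝ (Fin n),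
      LinearMap.det L ≠ 0 ∧ |LinearMap.det L| = Real.sqrt A.det ∧ ∀ x, D x x = ‖L x‖ ^ 2 := by
  obtain ⟨B, hB⟩ := CStarAlgebra.nonneg_iff_eq_star_mul_self.mp hA.posSemidef.nonneg
  have hdet : A.det = B.det ^ 2 := by
    rw [hB, Matrix.det_mul, Matrix.star_eq_conjTranspose, Matrix.det_conjTranspose]
    simp [sq]
  refine ⟨B.toLpLin 2 2, ?_, ?_, fun x => ?_⟩
  · rw [LinearMap.det_toLpLin]
    intro h0
    have := hA.det_pos
    simp [hdet, h0] at this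
  · rw [LinearMap.det_toLpLin, hdet, Real.sqrt_sq_eq_abs]
  · have hx : x = ∑ i, x i • EuclideanSpace.single i (1 : ℝ) := by
      simpa using ((EuclideanSpace.basisFun (Fin n) ℝ).sum_repr x).symm
    have hDx : D x x = ∑ i, ∑ j, x i * x j * A i j := by
      conv_lhs => rw [hx]
      simp only [map_sum, map_smul, _root_.sum_apply, _root_.smul_apply,
        smul_eq_mul, hAD]
      rw [Finset.sum_comm]
      simp only [Finset.mul_sum]
      refine Finset.sum_congr rfl fun i _ => Finset.sum_congr rfl fun j _ => ?_
      ring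
    have hentry : ∀ i j, A i j = ∑ k, B k i * B k j := fun i j => by
      rw [hB, Matrix.mul_apply]
      simp [Matrix.star_apply]
    have hsq : ∀ k, ‖B.toLpLin 2 2 x k‖ ^ 2 = ∑ i, ∑ j, B k i * x i * (B k j * x j) := fun k => by
      rw [Real.norm_eq_abs, sq_abs, sq, ← Finset.sum_mul_sum]
      rfl
    rw [hDx, EuclideanSpace.norm_sq_eq]
    simp only [hsq]
    conv_rhs => rw [Finset.sum_comm]
    refine Finset.sum_congr rfl fun i _ => ?_
    rw [Finset.sum_comm]
    refine Finset.sum_congr rfl fun j _ => ?_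
    rw [hentry, Finset.mul_sum]
    exact Finset.sum_congr rfl fun k _ => by ring

theorem Complex.norm_exp_half_mul_log_le (n : ℕ) {z : ℂ} (hz : z ≠ 0) {R : ℝ} (hR : ‖z‖ ≤ R) :
    ‖exp ((n : ℂ) / 2 * log z)‖ ≤ R ^ ((n : ℝ) / 2) := by
  have hre : ((n : ℂ) / 2 * log z).re = Real.log ‖z‖ * ((n : ℝ) / 2) := by
    have hn : (n : ℂ) / 2 = (((n : ℝ) / 2 : ℝ) : ℂ) := by push_cast; rfl
    rw [hn, re_ofReal_mul, log_re, mul_comm]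
  rw [norm_exp, hre, ← Real.rpow_def_of_pos (norm_pos_iff.2 hz)]
  gcongr

theorem Complex.exp_mul_setIntegral_exp_neg_mul {E : Type*} [MeasurableSpace E] (μ : Measure E)
    (U : Set E) (S φ : E → ℝ) (g : E → ℂ) (z : ℂ) (τ : ℝ) :
    exp (z * τ) * (∫ x in U, exp (-z * S x) * φ x * g x ∂μ) =
      ∫ x in U, exp (-z * ((S x - τ : ℝ) : ℂ)) * (φ x * g x) ∂μ := by
  rw [← integral_const_mul]
  refine integral_congr_ae (Filter.Eventually.of_forall fun x => ?_)
  have hexp : exp (-z * ((S x - τ : ℝ) : ℂ)) = exp (z * τ) * exp (-z * S x) := by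
    rw [← exp_add]
    congr 1
    push_cast
    ring
  simp only [hexp]
  ring

/-- uniform non-degenerate Laplace asymptotics with a complex
parameter-dependent amplitude (second assertion of Proposition 6.2 of the paper). -/
theorem stmt_18 (n : ℕ) (hn : 1 ≤ n) (δ₀ : ℝ) (hδ₀0 : 0 < δ₀) (hδ₀1 : δ₀ < 1)
    (U : Set (EuclideanSpace ℝ (Fin n))) (hUo : IsOpen U)
    (hUb : Bornology.IsBounded U) (hU0 : (0 : EuclideanSpace ℝ (Fin n)) ∈ U)
    (S : EuclideanSpace ℝ (Fin n) → ℝ) (hS : ContDiffOn ℝ 2 S U)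
    (τ : ℝ) (hS0 : S 0 = τ) (hgrad : fderiv ℝ S 0 = 0)
    (hSmin : ∀ σ ∈ U, σ ≠ 0 → τ < S σ)
    (A : Matrix (Fin n) (Fin n) ℝ)
    (hA : ∀ i j, A i j = iteratedFDeriv ℝ 2 S 0
      ![EuclideanSpace.single i (1 : ℝ), EuclideanSpace.single j (1 : ℝ)])
    (hApd : A.PosDef)
    (C₀' : ℝ) (hC₀' : 0 < C₀') (hcoer : ∀ σ ∈ U, τ + C₀' * ‖σ‖ ^ 2 ≤ S σ)
    (φ : EuclideanSpace ℝ (Fin n) → ℝ) (hφcont : Continuous φ)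
    (hφsupp : HasCompactSupport φ) (hφU : tsupport φ ⊆ U)
    (hφ0 : ∀ σ, 0 ≤ φ σ) (hφ1 : ∀ σ, φ σ ≤ 1) (hφat0 : φ 0 = 1)
    (μ₀ : ℝ) (hμ₀ : 0 < μ₀) (h : EuclideanSpace ℝ (Fin n) → ℂ → ℂ)
    (hcont : ∀ lam : ℂ, δ₀ * |lam.im| ≤ lam.re → μ₀ ≤ lam.re →
      ContinuousOn (fun σ => h σ lam) U)
    (hbdd : ∃ M : ℝ, ∀ σ ∈ U, ∀ lam : ℂ, δ₀ * |lam.im| ≤ lam.re → μ₀ ≤ lam.re →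
      ‖h σ lam‖ ≤ M)
    (hconv : ∀ ε : ℝ, 0 < ε → ∃ δ : ℝ, 0 < δ ∧ ∀ σ ∈ U, ‖σ‖ < δ →
      ∀ lam : ℂ, δ₀ * |lam.im| ≤ lam.re → μ₀ ≤ lam.re →
        ‖h σ lam - h 0 lam‖ ≤ ε) :
    ∀ ε : ℝ, 0 < ε → ∃ μ₁ : ℝ, μ₀ ≤ μ₁ ∧
      ∀ lam : ℂ, δ₀ * |lam.im| ≤ lam.re → μ₁ ≤ lam.re →
        ‖Complex.exp (((n : ℂ) / 2) * Complex.log lam) *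
            Complex.exp (lam * (τ : ℂ)) *
            (∫ σ in U, Complex.exp (-lam * (S σ : ℂ)) * (φ σ : ℂ) * h σ lam) -
          (((2 * Real.pi) ^ ((n : ℝ) / 2) / Real.sqrt A.det : ℝ) : ℂ) * h 0 lam‖ ≤
          ε := by
  intro ε hε
  obtain ⟨M₀, hM₀⟩ := hbdd
  set M := max M₀ 0 with hMdef
  have hM : 0 ≤ M := le_max_right _ _
  have hhM : ∀ σ ∈ U, ∀ lam : ℂ, δ₀ * |lam.im| ≤ lam.re → μ₀ ≤ lam.re → ‖h σ lam‖ ≤ M :=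
    fun σ hσ lam h1 h2 => (hM₀ σ hσ lam h1 h2).trans (le_max_left _ _)
  have hSat : ContDiffAt ℝ 2 S 0 := hS.contDiffAt (hUo.mem_nhds hU0)
  obtain ⟨L, hL0, hLdet, hLnorm⟩ := hApd.exists_norm_sq_eq (fderiv ℝ (fderiv ℝ S) 0)
    (fun i j => by rw [hA, iteratedFDeriv_two_apply]; rfl)
  have hLcont : Continuous L := L.continuous_of_finiteDimensional
  obtain ⟨κ, hκ, hanti⟩ := L.exists_antilipschitzWith
    (LinearMap.ker_eq_bot.2 (LinearMap.equivOfDetNeZero L hL0).injective)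
  have hκ' : (0 : ℝ) < κ := hκ
  set c := min C₀' (1 / (2 * (κ : ℝ) ^ 2)) with hcdef
  have hc : 0 < c := lt_min hC₀' (by positivity)
  have hQcoer : ∀ σ, c * ‖σ‖ ^ 2 ≤ 1 / 2 * ‖L σ‖ ^ 2 := by
    intro σ
    have h1 : ‖σ‖ ≤ κ * ‖L σ‖ := by simpa using hanti.le_mul_dist σ 0
    calc c * ‖σ‖ ^ 2 ≤ 1 / (2 * (κ : ℝ) ^ 2) * (κ * ‖L σ‖) ^ 2 := by
          gcongr
          exact min_le_right _ _
      _ = 1 / 2 * ‖L σ‖ ^ 2 := by field_simp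
  have hScoer : ∀ σ ∈ U, c * ‖σ‖ ^ 2 ≤ S σ - τ := by
    intro σ hσ
    have h1 : c * ‖σ‖ ^ 2 ≤ C₀' * ‖σ‖ ^ 2 := by
      gcongr
      exact min_le_left _ _
    linarith [hcoer σ hσ]
  set K := 1 + 1 / δ₀ with hKdef
  have hK : 0 < K := by positivity
  set G := (2 * Real.pi * K / c) ^ ((n : ℝ) / 2) with hGdef
  have hG : 0 < G := by positivity
  set η := ε / (2 * G * (1 + 2 * M * K / c)) with hηdef
  have hη : 0 < η := by positivity
  obtain ⟨δ₁, hδ₁, hTaylor⟩ := hSat.exists_abs_sub_half_snd_fderiv_le hgrad hη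
  obtain ⟨δ₂, hδ₂, hhδ⟩ := hconv (η / 2) (by positivity)
  obtain ⟨δ₃, hδ₃, hφδ⟩ := Metric.continuousAt_iff.1 (hφcont.continuousAt (x := 0))
    (η / (2 * (M + 1))) (by positivity)
  obtain ⟨δ₄, hδ₄, hUδ⟩ := Metric.isOpen_iff.1 hUo 0 hU0
  set δ := min (min δ₁ δ₂) (min δ₃ δ₄) with hδdef
  have hδ : 0 < δ := lt_min (lt_min hδ₁ hδ₂) (lt_min hδ₃ hδ₄)
  refine ⟨max μ₀ (8 * M * G / (c * δ ^ 2 * ε)), le_max_left _ _, fun lam hcone hre => ?_⟩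
  have hreμ₀ : μ₀ ≤ lam.re := (le_max_left _ _).trans hre
  have hre0 : 0 < lam.re := hμ₀.trans_le hreμ₀
  have hlamK : ‖lam‖ ≤ K * lam.re := by
    have h1 : |lam.im| ≤ lam.re / δ₀ := by
      rw [le_div_iff₀ hδ₀0]
      linarith
    calc ‖lam‖ ≤ |lam.re| + |lam.im| := Complex.norm_le_abs_re_add_abs_im lam
      _ ≤ lam.re + lam.re / δ₀ := by
          rw [abs_of_pos hre0]
          gcongr
      _ = K * lam.re := by rw [hKdef]; ring
  have hnear : ∀ σ, ‖σ‖ < δ → σ ∈ U ∧ |S σ - τ - 1 / 2 * ‖L σ‖ ^ 2| ≤ η * ‖σ‖ ^ 2 ∧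
      ‖(φ σ : ℂ) * h σ lam - h 0 lam‖ ≤ η := by
    intro σ hσ
    simp only [hδdef, lt_min_iff] at hσ
    obtain ⟨⟨hσ₁, hσ₂⟩, hσ₃, hσ₄⟩ := hσ
    have hσU : σ ∈ U := hUδ (by simpa using hσ₄)
    refine ⟨hσU, by simpa only [hS0, hLnorm] using hTaylor σ hσ₁, ?_⟩
    have h1 : |φ σ - 1| ≤ η / (2 * (M + 1)) := by
      have := (hφδ (x := σ) (by simpa using hσ₃)).le
      rwa [hφat0, Real.dist_eq] at this
    have h2 := hhδ σ hσU hσ₂ lam hcone hreμ₀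
    have h3 := hhM 0 hU0 lam hcone hreμ₀
    calc ‖(φ σ : ℂ) * h σ lam - h 0 lam‖
        = ‖((φ σ : ℝ) : ℂ) * (h σ lam - h 0 lam) + ((φ σ - 1 : ℝ) : ℂ) * h 0 lam‖ := by
          push_cast
          ring_nf
      _ ≤ |φ σ| * ‖h σ lam - h 0 lam‖ + |φ σ - 1| * ‖h 0 lam‖ := by
          refine (norm_add_le _ _).trans_eq ?_
          simp only [norm_mul, Complex.norm_real, Real.norm_eq_abs]
      _ ≤ 1 * (η / 2) + η / (2 * (M + 1)) * (M + 1) := by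
          rw [abs_of_nonneg (hφ0 σ)]
          gcongr
          · exact hφ1 σ
          · linarith
      _ = η := by field_simp; ring
  have hScont : ContinuousOn (fun σ => S σ - τ) U := hS.continuousOn.sub continuousOn_const
  have hgcont : ContinuousOn (fun σ => (φ σ : ℂ) * h σ lam) U :=
    (Complex.continuous_ofReal.comp hφcont).continuousOn.mul (hcont lam hcone hreμ₀)
  have hgM : ∀ σ ∈ U, ‖(φ σ : ℂ) * h σ lam‖ ≤ M := fun σ hσ => by
    rw [norm_mul, Complex.norm_real, Real.norm_eq_abs, abs_of_nonneg (hφ0 σ)]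
    exact (mul_le_of_le_one_left (norm_nonneg _) (hφ1 σ)).trans (hhM σ hσ lam hcone hreμ₀)
  have hQcont : Continuous fun σ => 1 / 2 * ‖L σ‖ ^ 2 := by fun_prop
  have hmain := norm_setIntegral_laplace_sub_gaussian_le hUo.measurableSet hc hM hK.le hη.le hδ
    hre0 hlamK hScont hgcont hQcont hScoer hQcoer hgM (hhM 0 hU0 lam hcone hreμ₀) hnear
  have hgauss := cpow_mul_integral_cexp_neg_mul_half_norm_sq hL0 hre0
  rw [finrank_euclideanSpace_fin] at hmain hgauss
  rw [hLdet] at hgauss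
  have hpow := Complex.norm_exp_half_mul_log_le n (by rintro rfl; simp at hre0) hlamK
  have hprod : (K * lam.re) ^ ((n : ℝ) / 2) * (2 * Real.pi / (c * lam.re)) ^ ((n : ℝ) / 2) = G := by
    rw [← Real.mul_rpow (by positivity) (by positivity), hGdef]
    congr 1
    field_simp
  have hsmall : 4 * M / (c * δ ^ 2 * lam.re) * G ≤ ε / 2 := by
    have h1 : 8 * M * G / (c * δ ^ 2 * ε) ≤ lam.re := (le_max_right _ _).trans hre
    rw [div_le_iff₀ (by positivity)] at h1
    rw [div_mul_eq_mul_div, div_le_iff₀ (by positivity)]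
    linarith
  rw [mul_assoc, Complex.exp_mul_setIntegral_exp_neg_mul, ← hgauss, mul_assoc, ← mul_sub, norm_mul]
  calc _ ≤ (K * lam.re) ^ ((n : ℝ) / 2) *
        ((η * (1 + 2 * M * K / c) + 4 * M / (c * δ ^ 2 * lam.re)) *
          (2 * Real.pi / (c * lam.re)) ^ ((n : ℝ) / 2)) := by gcongr
    _ = η * (1 + 2 * M * K / c) * G + 4 * M / (c * δ ^ 2 * lam.re) * G := by
        rw [← hprod]
        ring
    _ ≤ ε / 2 + ε / 2 := by
        gcongr
        rw [hηdef]
        apply le_of_eq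
        field_simp
    _ = ε := by ring
end
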